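/- Let n ≥ 1, c > 0, and f(x) = exp(c|x|²) on ℝ^{n+1}. For a bounded connected open set Ω ⊆ ℝ^{n+1} with smooth boundary, define λ₁(Ω) = inf { (∫_Ω |∇u|² f dx) / (∫_Ω u² f dx) : u ∈ C_c^∞(Ω), u not identically zero }. Let B be the open round ball centered at the origin with weighted volume vol(B) = vol(Ω). Then λ₁(Ω) ≥ λ₁(B), and equality holds if and only if Ω = B. -/

import Mathlib

open Filter MeasureTheory Set

/-- Weighted volume of a set `Ω ⊆ ℝ^{n+1}` with respect to the density `f`. -/
noncomputable def wvol {n : ℕ} (f : EuclideanSpace ℝ (Fin (n + 1)) → ℝ)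
    (Ω : Set (EuclideanSpace ℝ (Fin (n + 1)))) : ENNReal :=
  ∫⁻ x in Ω, ENNReal.ofReal (f x)

/-- `Ω` has smooth boundary: near every boundary point, `Ω` is the sublevel set of a
smooth function with nonvanishing differential. -/
def HasSmoothBoundary {n : ℕ} (Ω : Set (EuclideanSpace ℝ (Fin (n + 1)))) : Prop :=
  ∀ p ∈ frontier Ω, ∃ (U : Set (EuclideanSpace ℝ (Fin (n + 1))))
    (φ : EuclideanSpace ℝ (Fin (n + 1)) → ℝ), IsOpen U ∧ p ∈ U ∧ ContDiff ℝ (⊤ : ℕ∞) φ ∧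
      (∀ q ∈ U, fderiv ℝ φ q ≠ 0) ∧ Ω ∩ U = {q ∈ U | φ q < 0}

/-- The lowest Dirichlet eigenvalue of the operator `Lu = Δu − 2c⟨x, ∇u⟩` on `Ω`
(self-adjoint for the measure `f dx`, `f(x) = exp(c|x|²)`), defined as the infimum of
the Rayleigh quotients `(∫_Ω |∇u|² f dx)/(∫_Ω u² f dx)` over nonzero smooth compactly
supported test functions `u ∈ C_c^∞(Ω)`. -/
noncomputable def lambdaOne {n : ℕ} (f : EuclideanSpace ℝ (Fin (n + 1)) → ℝ)
    (Ω : Set (EuclideanSpace ℝ (Fin (n + 1)))) : ℝ :=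
  sInf {q : ℝ | ∃ u : EuclideanSpace ℝ (Fin (n + 1)) → ℝ,
    ContDiff ℝ (⊤ : ℕ∞) u ∧ HasCompactSupport u ∧ tsupport u ⊆ Ω ∧ u ≠ 0 ∧
    q = (∫ x in Ω, ‖gradient u x‖ ^ 2 * f x) / (∫ x in Ω, (u x) ^ 2 * f x)}

lemma fk_bm_compact {K L : Set ℝ} (hK : IsCompact K) (hL : IsCompact L) (hKn : K.Nonempty)
    (hLn : L.Nonempty) {C : Set ℝ} (hC : ∀ x ∈ K, ∀ y ∈ L, x + y ∈ C) :
    volume K + volume L ≤ volume C := by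
  obtain ⟨a, ha, hamax⟩ := hK.exists_isGreatest hKn
  obtain ⟨b, hb, hbmin⟩ := hL.exists_isLeast hLn
  have h1 : volume ((fun x => x + b) '' K) = volume K := by
    simp [Set.image_add_right, measure_preimage_add_right]
  have h2 : volume ((fun y => a + y) '' L) = volume L := by
    simp [Set.image_add_left, measure_preimage_add]
  have hmK : MeasurableSet ((fun x => x + b) '' K) :=
    (hK.image (by fun_prop)).measurableSet
  have hsub : ((fun x => x + b) '' K) ∪ ((fun y => a + y) '' L) ⊆ C := by
    rintro z (⟨x, hx, rfl⟩ | ⟨y, hy, rfl⟩)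
    · exact hC x hx b hb
    · exact hC a ha y hy
  have hint : ((fun x => x + b) '' K) ∩ ((fun y => a + y) '' L) ⊆ {a + b} := by
    rintro z ⟨⟨x, hx, rfl⟩, ⟨y, hy, hxy⟩⟩
    have := hamax hx
    have := hbmin hy
    simp only [mem_singleton_iff] at *
    linarith
  rw [← h1, ← h2, ← measure_union_add_inter' hmK]
  have : volume (((fun x => x + b) '' K) ∩ ((fun y => a + y) '' L)) = 0 :=
    measure_mono_null hint (by simp)
  rw [this, add_zero]
  exact measure_mono hsub

lemma fk_bm_one {A B C : Set ℝ} (hA : MeasurableSet A) (hB : MeasurableSet B)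
    (hAn : A.Nonempty) (hBn : B.Nonempty) (hC : ∀ x ∈ A, ∀ y ∈ B, x + y ∈ C) :
    volume A + volume B ≤ volume C := by
  obtain ⟨x0, hx0⟩ := hAn
  obtain ⟨y0, hy0⟩ := hBn
  rw [hA.measure_eq_iSup_isCompact, hB.measure_eq_iSup_isCompact]
  simp only [iSup_and']
  refine ENNReal.biSup_add_biSup_le' ⟨∅, by simp⟩ ⟨∅, by simp⟩ ?_
  rintro K ⟨hKA, hK⟩ L ⟨hLB, hL⟩
  calc volume K + volume L ≤ volume (insert x0 K) + volume (insert y0 L) := by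
        gcongr <;> exact Set.subset_insert _ _
    _ ≤ volume C := by
        refine fk_bm_compact (hK.insert _) (hL.insert _) ⟨x0, by simp⟩ ⟨y0, by simp⟩ ?_
        intro x hx y hy
        refine hC x ?_ y ?_
        · exact (Set.insert_subset hx0 hKA) hx
        · exact (Set.insert_subset hy0 hLB) hy

open scoped Pointwise in
lemma fk_bm_scaled {A B C : Set ℝ} (hA : MeasurableSet A) (hB : MeasurableSet B)
    (hAn : A.Nonempty) (hBn : B.Nonempty) {a b : ℝ} (ha : 0 < a) (hb : 0 < b)
    (hC : ∀ x ∈ A, ∀ y ∈ B, a * x + b * y ∈ C) :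
    ENNReal.ofReal a * volume A + ENNReal.ofReal b * volume B ≤ volume C := by
  have h1 : volume (a • A) = ENNReal.ofReal a * volume A := by
    rw [Measure.addHaar_smul]; simp [abs_of_pos ha]
  have h2 : volume (b • B) = ENNReal.ofReal b * volume B := by
    rw [Measure.addHaar_smul]; simp [abs_of_pos hb]
  rw [← h1, ← h2]
  refine fk_bm_one (hA.const_smul₀ a) (hB.const_smul₀ b) hAn.smul_set hBn.smul_set ?_
  rintro _ ⟨x, hx, rfl⟩ _ ⟨y, hy, rfl⟩
  exact hC x hx y hy

lemma fk_layer_unit (f : ℝ → ENNReal) (hf : Measurable f) (hf1 : ∀ x, f x ≤ 1) :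
    ∫⁻ x, f x = ∫⁻ t in Ioo (0:ℝ) 1, volume {x | ENNReal.ofReal t < f x} := by
  have h0 : ∀ x, f x = ENNReal.ofReal ((f x).toReal) := fun x =>
    (ENNReal.ofReal_toReal ((hf1 x).trans_lt ENNReal.one_lt_top).ne).symm
  have h1 : ∫⁻ x, f x = ∫⁻ x, ENNReal.ofReal ((f x).toReal) := lintegral_congr h0
  rw [h1, lintegral_eq_lintegral_meas_lt volume (Eventually.of_forall fun x => ENNReal.toReal_nonneg)
    hf.ennreal_toReal.aemeasurable]
  have h2 : Ioi (0:ℝ) = Ioo 0 1 ∪ Ici 1 := by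
    ext t; simp only [mem_Ioi, mem_union, mem_Ioo, mem_Ici]
    constructor
    · intro h; rcases lt_or_ge t 1 with h1 | h1
      · exact Or.inl ⟨h, h1⟩
      · exact Or.inr h1
    · rintro (h | h) <;> linarith [h]
  have hd : Disjoint (Ioo (0:ℝ) 1) (Ici 1) := by
    rw [Set.disjoint_left]; intro x hx hx'; exact absurd hx.2 (not_lt.mpr hx')
  rw [h2, lintegral_union measurableSet_Ici hd]
  have h3 : ∫⁻ t in Ici (1:ℝ), volume {x | t < (f x).toReal} = 0 := by
    rw [setLIntegral_congr_fun measurableSet_Ici (g := fun _ => 0)]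
    · simp
    · intro t ht
      have : {x | t < (f x).toReal} = ∅ := by
        ext x; simp only [mem_ofPred_eq, mem_empty_iff_false, iff_false, not_lt]
        exact (ENNReal.toReal_mono (by simp) (hf1 x)).trans (by simpa using ht)
      simp [this]
  rw [h3, add_zero]
  refine setLIntegral_congr_fun measurableSet_Ioo ?_
  intro t ht
  simp only
  congr 1
  ext x
  simp only [mem_ofPred_eq]
  rw [ENNReal.ofReal_lt_iff_lt_toReal ht.1.le ((hf1 x).trans_lt ENNReal.one_lt_top).ne]

lemma fk_pl_unit {l : ℝ} (hl0 : 0 < l) (hl1 : l < 1) (f g h : ℝ → ENNReal) (hf : Measurable f)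
    (hg : Measurable g) (hh : Measurable h) (hf1 : ⨆ x, f x = 1) (hg1 : ⨆ x, g x = 1)
    (H : ∀ x y, f x ^ (1 - l) * g y ^ l ≤ h ((1 - l) * x + l * y)) :
    ENNReal.ofReal (1 - l) * (∫⁻ x, f x) + ENNReal.ofReal l * (∫⁻ x, g x) ≤ ∫⁻ x, h x := by
  have hfle : ∀ x, f x ≤ 1 := fun x => hf1 ▸ le_iSup f x
  have hgle : ∀ x, g x ≤ 1 := fun x => hg1 ▸ le_iSup g x
  have hl' : 0 < 1 - l := by linarith
  calc _ ≤ ∫⁻ x, min (h x) 1 := by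
        rw [fk_layer_unit f hf hfle, fk_layer_unit g hg hgle,
          fk_layer_unit (fun x => min (h x) 1) (hh.min measurable_const) (fun x => min_le_right _ _)]
        have hmf : Measurable fun t : ℝ => volume {x | ENNReal.ofReal t < f x} := by
          apply Antitone.measurable
          intro s t hst
          apply measure_mono
          intro x hx
          exact (ENNReal.ofReal_le_ofReal hst).trans_lt hx
        rw [← lintegral_const_mul _ hmf, ← lintegral_const_mul' _ _ (by simp),
          ← lintegral_add_left (hmf.const_mul _)]
        refine setLIntegral_mono' measurableSet_Ioo ?_
        intro t ht
        have ht1 : ENNReal.ofReal t < 1 := by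
          rw [ENNReal.ofReal_lt_one]; exact ht.2
        refine fk_bm_scaled (measurableSet_lt measurable_const hf)
          (measurableSet_lt measurable_const hg) ?_ ?_ hl' hl0 ?_
        · rw [← hf1] at ht1
          exact lt_iSup_iff.mp ht1
        · rw [← hg1] at ht1
          exact lt_iSup_iff.mp ht1
        · intro x hx y hy
          simp only [mem_ofPred_eq] at hx hy ⊢
          refine lt_min ?_ ht1
          refine lt_of_lt_of_le ?_ (H x y)
          calc ENNReal.ofReal t = ENNReal.ofReal t ^ (1 - l) * ENNReal.ofReal t ^ l := by
                rw [← ENNReal.rpow_add _ _ (by simpa using ht.1) (by simp)]; simp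
            _ < _ := by
                apply ENNReal.mul_lt_mul
                · exact ENNReal.rpow_lt_rpow hx hl'
                · exact ENNReal.rpow_lt_rpow hy hl0
    _ ≤ _ := lintegral_mono fun x => min_le_left _ _

lemma fk_amgm {l : ℝ} (hl0 : 0 < l) (hl1 : l < 1) (a b : ENNReal) :
    a ^ (1 - l) * b ^ l ≤ ENNReal.ofReal (1 - l) * a + ENNReal.ofReal l * b := by
  have hl' : 0 < 1 - l := by linarith
  by_cases ha : a = ⊤
  · subst ha
    rw [ENNReal.mul_top (by simpa using hl')]; simp
  by_cases hb : b = ⊤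
  · subst hb
    rw [ENNReal.mul_top (by simpa using hl0)]; simp
  lift a to NNReal using ha
  lift b to NNReal using hb
  have := NNReal.geom_mean_le_arith_mean2_weighted (1 - l).toNNReal l.toNNReal a b (by
    rw [← Real.toNNReal_add hl'.le hl0.le]; simp)
  rw [Real.coe_toNNReal _ hl'.le, Real.coe_toNNReal _ hl0.le] at this
  rw [← ENNReal.coe_rpow_of_nonneg _ hl'.le, ← ENNReal.coe_rpow_of_nonneg _ hl0.le]
  unfold ENNReal.ofReal
  exact_mod_cast this

lemma fk_pl_bdd {l : ℝ} (hl0 : 0 < l) (hl1 : l < 1) (f g h : ℝ → ENNReal) (hf : Measurable f)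
    (hg : Measurable g) (hh : Measurable h) (hf1 : ⨆ x, f x ≠ ⊤) (hg1 : ⨆ x, g x ≠ ⊤)
    (H : ∀ x y, f x ^ (1 - l) * g y ^ l ≤ h ((1 - l) * x + l * y)) :
    (∫⁻ x, f x) ^ (1 - l) * (∫⁻ x, g x) ^ l ≤ ∫⁻ x, h x := by
  have hl' : 0 < 1 - l := by linarith
  set a := ⨆ x, f x with ha
  set b := ⨆ x, g x with hb
  by_cases ha0 : a = 0
  · have : ∀ x, f x = 0 := by simpa [ha] using ha0
    simp [this, ENNReal.zero_rpow_of_pos hl']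
  by_cases hb0 : b = 0
  · have : ∀ x, g x = 0 := by simpa [hb] using hb0
    simp [this, ENNReal.zero_rpow_of_pos hl0]
  have hai : a⁻¹ ≠ ⊤ := by simpa using ha0
  have hbi : b⁻¹ ≠ ⊤ := by simpa using hb0
  have key := fk_pl_unit hl0 hl1 (fun x => a⁻¹ * f x) (fun x => b⁻¹ * g x)
    (fun x => (a⁻¹ ^ (1 - l) * b⁻¹ ^ l) * h x) (hf.const_mul _) (hg.const_mul _) (hh.const_mul _)
    (by rw [← ENNReal.mul_iSup, ← ha, ENNReal.inv_mul_cancel ha0 hf1])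
    (by rw [← ENNReal.mul_iSup, ← hb, ENNReal.inv_mul_cancel hb0 hg1])
    (by
      intro x y
      rw [ENNReal.mul_rpow_of_nonneg _ _ hl'.le, ENNReal.mul_rpow_of_nonneg _ _ hl0.le]
      calc _ = (a⁻¹ ^ (1 - l) * b⁻¹ ^ l) * (f x ^ (1 - l) * g y ^ l) := by ring
        _ ≤ _ := by gcongr; exact H x y)
  rw [lintegral_const_mul _ hf, lintegral_const_mul _ hg, lintegral_const_mul _ hh] at key
  have key2 := (fk_amgm hl0 hl1 _ _).trans key
  rw [ENNReal.mul_rpow_of_nonneg _ _ hl'.le, ENNReal.mul_rpow_of_nonneg _ _ hl0.le] at key2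
  have e1 : a⁻¹ ^ (1 - l) * (∫⁻ x, f x) ^ (1 - l) * (b⁻¹ ^ l * (∫⁻ x, g x) ^ l)
    = (a⁻¹ ^ (1 - l) * b⁻¹ ^ l) * ((∫⁻ x, f x) ^ (1 - l) * (∫⁻ x, g x) ^ l) := by ring
  rw [e1] at key2
  have n1 : a⁻¹ ^ (1 - l) * b⁻¹ ^ l ≠ 0 := by
    apply mul_ne_zero
    · simp [hl', hf1, hl'.le, not_lt.mpr]
    · simp [hl0, hg1, hl0.le, not_lt.mpr]
  have n2 : a⁻¹ ^ (1 - l) * b⁻¹ ^ l ≠ ⊤ := by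
    apply ENNReal.mul_ne_top
    · exact ENNReal.rpow_ne_top_of_nonneg hl'.le hai
    · exact ENNReal.rpow_ne_top_of_nonneg hl0.le hbi
  exact (ENNReal.mul_le_mul_iff_right n1 n2).mp key2

/-- The Prékopa–Leindler property of a measure space. -/
def FKPL (E : Type) [AddCommGroup E] [Module ℝ E] [MeasureSpace E] : Prop :=
  ∀ l : ℝ, 0 < l → l < 1 → ∀ f g h : E → ENNReal, Measurable f → Measurable g → Measurable h →
    (∀ x y, f x ^ (1 - l) * g y ^ l ≤ h ((1 - l) • x + l • y)) →
    (∫⁻ x, f x) ^ (1 - l) * (∫⁻ x, g x) ^ l ≤ ∫⁻ x, h x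

lemma fk_trunc_tendsto (f : ℝ → ENNReal) (hf : Measurable f) :
    Tendsto (fun k : ℕ => ∫⁻ x, min (f x) k) atTop (nhds (∫⁻ x, f x)) := by
  refine lintegral_tendsto_of_tendsto_of_monotone
    (fun k => (hf.min measurable_const).aemeasurable) ?_ ?_
  · refine Eventually.of_forall fun x => ?_
    intro j k hjk
    simp only
    gcongr
  · refine Eventually.of_forall fun x => ?_
    have h1 : Tendsto (fun k : ℕ => (k : ENNReal)) atTop (nhds ⊤) := ENNReal.tendsto_nat_nhds_top
    have := (tendsto_const_nhds (x := f x)).min h1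
    simpa using this

lemma fkpl_real : FKPL ℝ := by
  intro l hl0 hl1 f g h hf hg hh H
  have hl' : 0 < 1 - l := by linarith
  by_cases hf0 : ∫⁻ x, f x = 0
  · simp [hf0, ENNReal.zero_rpow_of_pos hl']
  by_cases hg0 : ∫⁻ x, g x = 0
  · simp [hg0, ENNReal.zero_rpow_of_pos hl0]
  have t : Tendsto (fun k : ℕ => (∫⁻ x, min (f x) k) ^ (1 - l) * (∫⁻ x, min (g x) k) ^ l) atTop
      (nhds ((∫⁻ x, f x) ^ (1 - l) * (∫⁻ x, g x) ^ l)) := by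
    refine ENNReal.Tendsto.mul ?_ (Or.inl ?_) ?_ (Or.inl ?_)
    · exact (ENNReal.continuous_rpow_const.tendsto _).comp (fk_trunc_tendsto f hf)
    · simp [hf0, hl'.le, not_lt.mpr]
    · exact (ENNReal.continuous_rpow_const.tendsto _).comp (fk_trunc_tendsto g hg)
    · simp [hg0, hl0.le, not_lt.mpr]
  refine le_of_tendsto' t fun k => ?_
  refine fk_pl_bdd hl0 hl1 _ _ h (hf.min measurable_const) (hg.min measurable_const) hh ?_ ?_ ?_
  · exact ((iSup_le fun x => min_le_right (f x) (k : ENNReal)).trans_lt (by simp)).ne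
  · exact ((iSup_le fun x => min_le_right (g x) (k : ENNReal)).trans_lt (by simp)).ne
  · intro x y
    refine le_trans ?_ (H x y)
    gcongr
    · exact min_le_left _ _
    · exact min_le_left _ _

lemma fkpl_prod {E F : Type} [AddCommGroup E] [Module ℝ E] [MeasureSpace E] [AddCommGroup F]
    [Module ℝ F] [MeasureSpace F] [SFinite (volume : Measure F)] [SFinite (volume : Measure E)]
    (hE : FKPL E) (hF : FKPL F) :
    FKPL (E × F) := by
  intro l hl0 hl1 f g h hf hg hh H
  rw [Measure.volume_eq_prod, lintegral_prod _ hf.aemeasurable, lintegral_prod _ hg.aemeasurable,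
    lintegral_prod _ hh.aemeasurable]
  refine hE l hl0 hl1 _ _ _ hf.lintegral_prod_right' hg.lintegral_prod_right'
    hh.lintegral_prod_right' ?_
  intro x x'
  refine hF l hl0 hl1 _ _ _ (hf.comp measurable_prodMk_left) (hg.comp measurable_prodMk_left)
    (hh.comp measurable_prodMk_left) ?_
  intro y y'
  exact H (x, y) (x', y')

lemma fkpl_of_equiv {E F : Type} [AddCommGroup E] [Module ℝ E] [MeasureSpace E] [AddCommGroup F]
    [Module ℝ F] [MeasureSpace F] (hE : FKPL E) (e : E → F) (he : MeasurePreserving e volume volume)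
    (hadd : ∀ x y, e (x + y) = e x + e y) (hsmul : ∀ (a : ℝ) x, e (a • x) = a • e x) :
    FKPL F := by
  intro l hl0 hl1 f g h hf hg hh H
  rw [← he.lintegral_comp hf, ← he.lintegral_comp hg, ← he.lintegral_comp hh]
  refine hE l hl0 hl1 _ _ _ (hf.comp he.measurable) (hg.comp he.measurable)
    (hh.comp he.measurable) ?_
  intro x y

  rw [hadd, hsmul, hsmul]
  exact H _ _

lemma fkpl_pi (n : ℕ) : FKPL (Fin n → ℝ) := by
  induction n with
  | zero =>
    intro l hl0 hl1 f g h hf hg hh H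
    have hv : (volume : Measure (Fin 0 → ℝ)) = Measure.dirac 0 := by
      rw [volume_pi]
      exact Measure.pi_of_empty _ _
    rw [hv, lintegral_dirac, lintegral_dirac, lintegral_dirac]
    simpa using H 0 0
  | succ n ih =>
    have h1 := fkpl_prod fkpl_real ih
    have h2 := (volume_preserving_piFinSuccAbove (fun _ : Fin (n + 1) => ℝ) 0).symm
    refine fkpl_of_equiv h1 _ h2 ?_ ?_
    · intro x y
      ext i
      refine Fin.cases ?_ (fun i => ?_) i <;> simp [MeasurableEquiv.piFinSuccAbove, Fin.insertNthEquiv]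
    · intro a x
      ext i
      refine Fin.cases ?_ (fun i => ?_) i <;> simp [MeasurableEquiv.piFinSuccAbove, Fin.insertNthEquiv]

lemma fkpl_euclidean (n : ℕ) : FKPL (EuclideanSpace ℝ (Fin n)) := by
  refine fkpl_of_equiv (fkpl_pi n) _ (PiLp.volume_preserving_toLp (Fin n)) ?_ ?_
  · intro x y; rfl
  · intro a x; rfl

lemma fk_bm_ball (n : ℕ) {A : Set (EuclideanSpace ℝ (Fin (n + 1)))} (hA : IsOpen A) {a ε : ℝ}
    (ha : 0 < a) (hε : 0 < ε)
    (hvol : volume A = volume (Metric.ball (0 : EuclideanSpace ℝ (Fin (n + 1))) a)) :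
    volume (Metric.ball (0 : EuclideanSpace ℝ (Fin (n + 1))) (a + ε)) ≤
      volume (Metric.thickening ε A) := by
  have hs : 0 < a + ε := by linarith
  set T := Metric.thickening ε A with hT
  set W := Metric.ball (0 : EuclideanSpace ℝ (Fin (n + 1))) 1 with hW
  set l := ε / (a + ε) with hl
  have hl0 : 0 < l := by positivity
  have hl1 : l < 1 := by rw [hl, div_lt_one hs]; linarith
  have hl' : 0 < 1 - l := by linarith
  have hTm : MeasurableSet T := Metric.isOpen_thickening.measurableSet
  have m1 : MeasurableSet ((fun x : EuclideanSpace ℝ (Fin (n + 1)) => a • x) ⁻¹' A) :=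
    hA.measurableSet.preimage (by fun_prop)
  have m2 : MeasurableSet W := Metric.isOpen_ball.measurableSet
  have m3 : MeasurableSet ((fun x : EuclideanSpace ℝ (Fin (n + 1)) => (a + ε) • x) ⁻¹' T) :=
    hTm.preimage (by fun_prop)
  have key := fkpl_euclidean (n + 1) l hl0 hl1
    (indicator ((fun x => a • x) ⁻¹' A) 1) (indicator W 1)
    (indicator ((fun x => (a + ε) • x) ⁻¹' T) 1)
    (measurable_one.indicator m1) (measurable_one.indicator m2) (measurable_one.indicator m3)
    (by
      intro x y
      by_cases hx : x ∈ (fun x => a • x) ⁻¹' A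
      swap
      · simp [indicator_of_notMem hx, ENNReal.zero_rpow_of_pos hl']
      by_cases hy : y ∈ W
      swap
      · simp [indicator_of_notMem hy, ENNReal.zero_rpow_of_pos hl0]
      have : (1 - l) • x + l • y ∈ (fun x => (a + ε) • x) ⁻¹' T := by
        simp only [mem_preimage] at hx ⊢
        rw [hT, Metric.mem_thickening_iff]
        refine ⟨_, hx, ?_⟩
        have e : (a + ε) • ((1 - l) • x + l • y) = a • x + ε • y := by
          rw [smul_add, smul_smul, smul_smul]
          congr 2
          · rw [hl]; field_simp; ring
          · rw [hl]; field_simp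
        rw [e, dist_eq_norm, add_sub_cancel_left, norm_smul, Real.norm_of_nonneg hε.le]
        have : ‖y‖ < 1 := by simpa [hW] using hy
        nlinarith
      simp [indicator_of_mem hx, indicator_of_mem hy, indicator_of_mem this])
  rw [lintegral_indicator_one m1, lintegral_indicator_one m2, lintegral_indicator_one m3,
    Measure.addHaar_preimage_smul _ ha.ne', Measure.addHaar_preimage_smul _ hs.ne', hvol,
    Measure.addHaar_ball _ _ ha.le, ← mul_assoc, ← ENNReal.ofReal_mul (abs_nonneg _)] at key
  have hWfin : volume W ≠ ⊤ := measure_ball_lt_top.ne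
  have hW0 : volume W ≠ 0 := (Metric.measure_ball_pos _ _ one_pos).ne'
  have e1 : |(a ^ Module.finrank ℝ (EuclideanSpace ℝ (Fin (n + 1))))⁻¹| *
    a ^ Module.finrank ℝ (EuclideanSpace ℝ (Fin (n + 1))) = 1 := by
    rw [abs_of_pos (by positivity)]; field_simp
  rw [e1, ENNReal.ofReal_one, one_mul, ← hW, ← ENNReal.rpow_add _ _ hW0 hWfin] at key
  rw [Measure.addHaar_ball _ _ hs.le]
  have hp : 0 < (a + ε) ^ Module.finrank ℝ (EuclideanSpace ℝ (Fin (n + 1))) := by positivity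
  calc _ ≤ ENNReal.ofReal ((a + ε) ^ Module.finrank ℝ (EuclideanSpace ℝ (Fin (n + 1)))) *
        (ENNReal.ofReal |((a + ε) ^ Module.finrank ℝ (EuclideanSpace ℝ (Fin (n + 1))))⁻¹| * volume T) := by
        gcongr
        simpa using key
    _ = volume T := by
        rw [← mul_assoc, ← ENNReal.ofReal_mul hp.le, abs_of_pos (by positivity)]
        rw [mul_inv_cancel₀ hp.ne']; simp

/-- Volume of the unit ball. -/
noncomputable def fkω (n : ℕ) : ℝ :=
  (volume (Metric.ball (0 : EuclideanSpace ℝ (Fin (n + 1))) 1)).toReal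

lemma fkω_pos (n : ℕ) : 0 < fkω n :=
  ENNReal.toReal_pos (Metric.measure_ball_pos _ _ one_pos).ne' measure_ball_lt_top.ne

lemma fk_vol_ball (n : ℕ) {a : ℝ} (ha : 0 ≤ a) :
    volume (Metric.ball (0 : EuclideanSpace ℝ (Fin (n + 1))) a)
      = ENNReal.ofReal (fkω n * a ^ (n + 1)) := by
  rw [Measure.addHaar_ball _ _ ha, mul_comm (fkω n), ENNReal.ofReal_mul (by positivity), fkω,
    ENNReal.ofReal_toReal measure_ball_lt_top.ne]
  simp

/-- Radius of the ball of volume `m`. -/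
noncomputable def fkrad (n : ℕ) (m : ENNReal) : ℝ := (m.toReal / fkω n) ^ ((1 : ℝ) / (n + 1))

lemma fkrad_nonneg (n : ℕ) (m : ENNReal) : 0 ≤ fkrad n m :=
  Real.rpow_nonneg (div_nonneg ENNReal.toReal_nonneg (fkω_pos n).le) _

lemma fkrad_pow (n : ℕ) (m : ENNReal) : fkω n * fkrad n m ^ (n + 1) = m.toReal := by
  have h : 0 ≤ m.toReal / fkω n := div_nonneg ENNReal.toReal_nonneg (fkω_pos n).le
  rw [fkrad, ← Real.rpow_natCast, ← Real.rpow_mul h]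
  have := fkω_pos n
  have h2 : (1 : ℝ) / (n + 1) * ((n + 1 : ℕ) : ℝ) = 1 := by
    push_cast; field_simp
  rw [h2, Real.rpow_one]; field_simp

lemma fkrad_vol (n : ℕ) {m : ENNReal} (hm : m ≠ ⊤) :
    volume (Metric.ball (0 : EuclideanSpace ℝ (Fin (n + 1))) (fkrad n m)) = m := by
  rw [fk_vol_ball n (fkrad_nonneg n m), fkrad_pow, ENNReal.ofReal_toReal hm]

lemma fkrad_mono (n : ℕ) {m m' : ENNReal} (h : m ≤ m') (hm : m' ≠ ⊤) : fkrad n m ≤ fkrad n m' := by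
  unfold fkrad
  have := fkω_pos n
  have h2 := ENNReal.toReal_mono hm h
  apply Real.rpow_le_rpow (by positivity) (by gcongr) (by positivity)

lemma fk_taylor {n : ℕ} {w : EuclideanSpace ℝ (Fin (n + 1)) → ℝ} (hw : ContDiff ℝ 2 w)
    (hc : HasCompactSupport w) : ∃ C : ℝ, 0 ≤ C ∧ ∀ x y, w y ≤ w x + ‖fderiv ℝ w x‖ * ‖y - x‖
      + C * ‖y - x‖ ^ 2 := by
  obtain ⟨C, hC⟩ := ContDiff.lipschitzWith_of_hasCompactSupport (𝕂 := ℝ) (hc.fderiv ℝ)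
    (hw.fderiv_right (m := 1) (by norm_num)) one_ne_zero
  refine ⟨C, C.2, fun x y => ?_⟩
  have h := Convex.norm_image_sub_le_of_norm_hasFDerivWithin_le' (f := w) (f' := fderiv ℝ w)
    (φ := fderiv ℝ w x) (s := Metric.closedBall x ‖y - x‖) (C := C * ‖y - x‖) (x := x) (y := y)
    (fun z _ => ((hw.differentiable (by norm_num)) z).hasFDerivAt.hasFDerivWithinAt)
    (fun z hz => by
      have := hC.dist_le_mul z x
      rw [dist_eq_norm, dist_eq_norm] at this
      refine this.trans ?_
      gcongr
      simpa [dist_eq_norm] using hz) (convex_closedBall _ _) (by simp) (by simp [dist_eq_norm])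
  have h1 := (fderiv ℝ w x).le_opNorm (y - x)
  have h2 := (abs_le.mp (show |w y - w x - (fderiv ℝ w x) (y - x)| ≤ _ from h)).2
  have h3 := (abs_le.mp (show |(fderiv ℝ w x) (y - x)| ≤ _ from h1)).2
  nlinarith

lemma fk_layer {n : ℕ} {w : EuclideanSpace ℝ (Fin (n + 1)) → ℝ} (hw : Measurable w)
    (hw0 : ∀ x, 0 ≤ w x) {τ : ℝ} :
    ∫⁻ t in Ioo 0 τ, volume {x | t < w x} = ∫⁻ x, ENNReal.ofReal (min (w x) τ) := by
  by_cases hτ : 0 < τ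
  swap
  · have : Ioo 0 τ = ∅ := Ioo_eq_empty hτ
    rw [this]
    simp only [Measure.restrict_empty, lintegral_zero_measure]
    symm
    rw [lintegral_eq_zero_iff (by fun_prop)]
    refine Eventually.of_forall fun x => ?_
    simp only [Pi.zero_apply, ENNReal.ofReal_eq_zero]
    exact (min_le_right _ _).trans (not_lt.mp hτ)
  rw [lintegral_eq_lintegral_meas_lt volume
    (Eventually.of_forall fun x => le_min (hw0 x) hτ.le) (by fun_prop)]
  have h2 : Ioi (0:ℝ) = Ioo 0 τ ∪ Ici τ := (Ioo_union_Ici_eq_Ioi hτ).symm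
  have hd : Disjoint (Ioo (0:ℝ) τ) (Ici τ) := by
    rw [Set.disjoint_left]; intro x hx hx'; exact absurd hx.2 (not_lt.mpr hx')
  rw [h2, lintegral_union measurableSet_Ici hd]
  have h3 : ∫⁻ t in Ici τ, volume {x | t < min (w x) τ} = 0 := by
    rw [setLIntegral_congr_fun measurableSet_Ici (g := fun _ => 0)]
    · simp
    · intro t ht
      have : {x | t < min (w x) τ} = ∅ := by
        ext x; simp only [mem_ofPred_eq, mem_empty_iff_false, iff_false, not_lt]
        exact (min_le_right _ _).trans ht
      simp only [this, measure_empty]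
  rw [h3, add_zero]
  refine setLIntegral_congr_fun measurableSet_Ioo ?_
  intro t ht
  simp only
  congr 1
  ext x
  simp [ht.2]

lemma fk_iso {n : ℕ} (hn : 1 ≤ n) {w : EuclideanSpace ℝ (Fin (n + 1)) → ℝ} (hw : ContDiff ℝ 2 w)
    (hc : HasCompactSupport w) (hw0 : ∀ x, 0 ≤ w x) {τ : ℝ} (hτ : 0 < τ) :
    ∫⁻ t in Ioo 0 τ, ENNReal.ofReal ((n + 1) * fkω n * fkrad n (volume {x | t < w x}) ^ n)
      ≤ ∫⁻ x in {x | w x < τ}, ENNReal.ofReal ‖fderiv ℝ w x‖ := by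
  obtain ⟨C, hC0, hC⟩ := fk_taylor hw hc
  have hwc : Continuous w := hw.continuous
  have hdc : Continuous (fun x => ‖fderiv ℝ w x‖) := (hw.continuous_fderiv (by norm_num)).norm
  set K := Metric.cthickening 1 (tsupport w) with hK
  have hKc : IsCompact K := hc.isCompact.cthickening
  have hKm : MeasurableSet K := hKc.measurableSet
  have hKf : volume K ≠ ⊤ := hKc.measure_lt_top.ne
  have hsm : MeasurableSet {x | w x < τ} := measurableSet_lt hwc.measurable measurable_const
  have hfin : ∀ t, 0 ≤ t → volume {x | t < w x} ≠ ⊤ := by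
    intro t ht
    refine (lt_of_le_of_lt (measure_mono ?_) hc.isCompact.measure_lt_top).ne
    intro x hx
    apply subset_tsupport
    simp only [mem_ofPred_eq] at hx
    simp only [Function.mem_support]; linarith
  have hmeas : Measurable fun t : ℝ => volume {x | t < w x} := by
    apply Antitone.measurable
    intro s t hst
    apply measure_mono
    intro x hx
    exact hst.trans_lt hx
  have hmin : ∫⁻ t in Ioo 0 τ, volume {x | t < w x} ≠ ⊤ := by
    rw [fk_layer hwc.measurable hw0]
    refine (lt_of_le_of_lt (b := ∫⁻ x in K, ENNReal.ofReal τ) ?_ ?_).ne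
    · rw [← lintegral_indicator hKm]
      apply lintegral_mono
      intro x
      by_cases hx : x ∈ K
      · simp only [indicator_of_mem hx]
        exact ENNReal.ofReal_le_ofReal (min_le_right _ _)
      · have : w x = 0 := by
          by_contra h
          exact hx (Metric.self_subset_cthickening _ (subset_tsupport _ h))
        simp [this]
    · simp [ENNReal.mul_lt_top, hKf.lt_top]
  have hmain : ∀ ε : ℝ, 0 < ε → ε < 1 →
      ∫⁻ t in Ioo 0 τ, ENNReal.ofReal ((n + 1) * fkω n * fkrad n (volume {x | t < w x}) ^ n)
      ≤ (∫⁻ x in {x | w x < τ}, ENNReal.ofReal ‖fderiv ℝ w x‖) + ENNReal.ofReal ε *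
        (ENNReal.ofReal C * volume K) := by
    intro ε hε hε1
    set g : EuclideanSpace ℝ (Fin (n + 1)) → ℝ := fun x => min (w x) τ +
      (indicator {x | w x < τ} (fun x => ε * ‖fderiv ℝ w x‖) x
        + indicator K (fun x => C * ε ^ 2) x) with hg
    have hg0 : ∀ x, 0 ≤ g x := by
      intro x
      have h1 : 0 ≤ indicator {x | w x < τ} (fun x => ε * ‖fderiv ℝ w x‖) x :=
        indicator_nonneg (fun _ _ => by positivity) _
      have h2 : 0 ≤ indicator K (fun x => C * ε ^ 2) x :=
        indicator_nonneg (fun _ _ => by positivity) _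
      have h3 : 0 ≤ min (w x) τ := le_min (hw0 x) hτ.le
      simp only [hg]; linarith
    have hgm : Measurable g := by
      refine (hwc.measurable.min measurable_const).add (Measurable.add ?_ ?_)
      · exact (hdc.measurable.const_mul _).indicator hsm
      · exact measurable_const.indicator hKm
    have hgi : ∫⁻ x, ENNReal.ofReal (g x) = (∫⁻ t in Ioo 0 τ, volume {x | t < w x}) +
        ENNReal.ofReal ε * ((∫⁻ x in {x | w x < τ}, ENNReal.ofReal ‖fderiv ℝ w x‖) +
          ENNReal.ofReal ε * (ENNReal.ofReal C * volume K)) := by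
      have e : ∀ x, ENNReal.ofReal (g x) = ENNReal.ofReal (min (w x) τ) +
        (indicator {x | w x < τ} (fun x => ENNReal.ofReal ε * ENNReal.ofReal ‖fderiv ℝ w x‖) x
         + indicator K (fun x => ENNReal.ofReal (C * ε ^ 2)) x) := by
        intro x
        have h1 : 0 ≤ indicator {x | w x < τ} (fun x => ε * ‖fderiv ℝ w x‖) x :=
          indicator_nonneg (fun _ _ => by positivity) _
        have h2 : 0 ≤ indicator K (fun x => C * ε ^ 2) x :=
          indicator_nonneg (fun _ _ => by positivity) _
        have h3 : 0 ≤ min (w x) τ := le_min (hw0 x) hτ.le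
        simp only [hg]
        rw [ENNReal.ofReal_add h3 (add_nonneg h1 h2), ENNReal.ofReal_add h1 h2]
        congr 2
        · by_cases hx : x ∈ {x | w x < τ}
          · simp only [indicator_of_mem hx, ENNReal.ofReal_mul hε.le]
          · simp only [indicator_of_notMem hx, ENNReal.ofReal_zero]
        · by_cases hx : x ∈ K
          · simp only [indicator_of_mem hx]
          · simp only [indicator_of_notMem hx, ENNReal.ofReal_zero]
      simp_rw [e]
      rw [lintegral_add_left (by fun_prop), lintegral_add_right _ (measurable_const.indicator hKm),
        lintegral_indicator hsm, lintegral_indicator hKm, fk_layer hwc.measurable hw0,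
        lintegral_const_mul _ (by fun_prop)]
      congr 1
      simp only [lintegral_const, MeasurableSet.univ, Measure.restrict_apply, univ_inter]
      rw [mul_add, pow_two, ENNReal.ofReal_mul hC0, ENNReal.ofReal_mul hε.le]
      ring
    have hlow : (∫⁻ t in Ioo 0 τ, volume {x | t < w x}) + ENNReal.ofReal ε *
        (∫⁻ t in Ioo 0 τ, ENNReal.ofReal ((n + 1) * fkω n * fkrad n (volume {x | t < w x}) ^ n))
        ≤ ∫⁻ x, ENNReal.ofReal (g x) := by
      rw [← lintegral_const_mul' _ _ (by simp), ← lintegral_add_left hmeas]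
      rw [lintegral_eq_lintegral_meas_lt volume (Eventually.of_forall hg0) hgm.aemeasurable]
      refine le_trans ?_ (lintegral_mono_set (s := Ioo 0 τ) Ioo_subset_Ioi_self)
      refine setLIntegral_mono' measurableSet_Ioo ?_
      intro t ht
      set ρ := fkrad n (volume {x | t < w x}) with hρ
      have hρ0 : 0 ≤ ρ := fkrad_nonneg _ _
      have hv : volume {x | t < w x} = volume (Metric.ball (0 : EuclideanSpace ℝ (Fin (n + 1))) ρ) :=
        (fkrad_vol n (hfin t ht.1.le)).symm
      rcases hρ0.eq_or_lt with h0 | hpos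
      · rw [← h0, zero_pow (by omega), mul_zero, ENNReal.ofReal_zero, mul_zero, add_zero, hv, ← h0]
        simp
      have hopen : IsOpen {x | t < w x} := isOpen_lt continuous_const hwc
      calc _ = ENNReal.ofReal (fkω n * ρ ^ (n + 1)) +
              ENNReal.ofReal ε * ENNReal.ofReal ((n + 1) * fkω n * ρ ^ n) := by
            rw [hv, fk_vol_ball n hρ0]
        _ = ENNReal.ofReal (fkω n * (ρ ^ (n + 1) + (n + 1) * ρ ^ n * ε)) := by
            have := fkω_pos n
            rw [← ENNReal.ofReal_mul hε.le, ← ENNReal.ofReal_add (by positivity) (by positivity)]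
            congr 1; ring
        _ ≤ ENNReal.ofReal (fkω n * (ρ + ε) ^ (n + 1)) := by
            apply ENNReal.ofReal_le_ofReal
            apply mul_le_mul_of_nonneg_left _ (fkω_pos n).le
            have hb := one_add_mul_le_pow (a := ε / ρ) (by have : 0 < ε / ρ := by positivity
                                                           linarith) (n + 1)
            have e1 : (ρ + ε) ^ (n + 1) = ρ ^ (n + 1) * (1 + ε / ρ) ^ (n + 1) := by
              rw [← mul_pow]; congr 1; field_simp
            have e2 : ρ ^ (n + 1) + (n + 1) * ρ ^ n * ε
              = ρ ^ (n + 1) * (1 + ((n + 1 : ℕ) : ℝ) * (ε / ρ)) := by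
              push_cast; field_simp; ring
            rw [e1, e2]
            gcongr
        _ = volume (Metric.ball (0 : EuclideanSpace ℝ (Fin (n + 1))) (ρ + ε)) :=
            (fk_vol_ball n (by positivity)).symm
        _ ≤ volume (Metric.thickening ε {x | t < w x}) := fk_bm_ball n hopen hpos hε hv
        _ ≤ _ := by
            apply measure_mono
            intro x hx
            rw [Metric.mem_thickening_iff] at hx
            obtain ⟨a, ha, hxa⟩ := hx
            simp only [mem_ofPred_eq] at ha ⊢
            have hat : a ∈ tsupport w := by
              apply subset_tsupport
              simp only [Function.mem_support]; linarith [ht.1]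
            have hxK : x ∈ K := Metric.mem_cthickening_of_dist_le x a 1 _ hat (by linarith)
            have hT := hC x a
            rw [← dist_eq_norm, dist_comm] at hT
            have h1 : ‖fderiv ℝ w x‖ * dist x a ≤ ‖fderiv ℝ w x‖ * ε := by gcongr
            have h2 : C * dist x a ^ 2 ≤ C * ε ^ 2 := by gcongr
            simp only [hg, indicator_of_mem hxK]
            by_cases hxt : w x < τ
            · rw [indicator_of_mem (show x ∈ {x | w x < τ} from hxt), min_eq_left hxt.le]
              linarith
            · rw [indicator_of_notMem (show x ∉ {x | w x < τ} from hxt), min_eq_right (not_lt.mp hxt)]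
              have : 0 ≤ C * ε ^ 2 := by positivity
              linarith [ht.2]
    rw [hgi] at hlow
    have h2 := (ENNReal.add_le_add_iff_left hmin).mp hlow
    exact (ENNReal.mul_le_mul_iff_right (by simpa using hε) (by simp)).mp h2
  have hD : ENNReal.ofReal C * volume K ≠ ⊤ := ENNReal.mul_ne_top (by simp) hKf
  refine ge_of_tendsto (x := nhdsWithin (0:ℝ) (Ioi 0)) (f := fun ε : ℝ =>
    (∫⁻ x in {x | w x < τ}, ENNReal.ofReal ‖fderiv ℝ w x‖) + ENNReal.ofReal ε *
        (ENNReal.ofReal C * volume K)) ?_ ?_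
  · have t1 : Tendsto (fun ε : ℝ => ENNReal.ofReal ε * (ENNReal.ofReal C * volume K))
      (nhdsWithin (0:ℝ) (Ioi 0)) (nhds (ENNReal.ofReal 0 * (ENNReal.ofReal C * volume K))) := by
      apply ENNReal.Tendsto.mul_const _ (Or.inr hD)
      exact (ENNReal.continuous_ofReal.tendsto 0).mono_left nhdsWithin_le_nhds
    have := (tendsto_const_nhds (x := ∫⁻ x in {x | w x < τ}, ENNReal.ofReal ‖fderiv ℝ w x‖)).add t1
    simpa using this
  · have : Ioo (0:ℝ) 1 ∈ nhdsWithin (0:ℝ) (Ioi 0) := Ioo_mem_nhdsGT one_pos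
    filter_upwards [this] with ε hε
    exact hmain ε hε.1 hε.2

lemma fk_lower {L : Set ℝ} (hL : IsLowerSet L) :
    L = ∅ ∨ L = univ ∨ (∃ a, L = Iio a) ∨ ∃ a, L = Iic a := by
  rcases L.eq_empty_or_nonempty with h | hne
  · exact Or.inl h
  by_cases hb : BddAbove L
  · right; right
    by_cases hs : sSup L ∈ L
    · right
      refine ⟨sSup L, ?_⟩
      ext x
      exact ⟨fun hx => le_csSup hb hx, fun hx => hL hx hs⟩
    · left
      refine ⟨sSup L, ?_⟩
      ext x
      constructor
      · intro hx
        exact lt_of_le_of_ne (le_csSup hb hx) (fun h => hs (h ▸ hx))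
      · intro hx
        obtain ⟨y, hy, hxy⟩ := exists_lt_of_lt_csSup hne hx
        exact hL hxy.le hy
  · right; left
    ext x
    simp only [mem_univ, iff_true]
    rw [not_bddAbove_iff] at hb
    obtain ⟨y, hy, hxy⟩ := hb x
    exact hL hxy.le hy

lemma fk_dom {ν₁ ν₂ : Measure ℝ} [IsFiniteMeasure ν₁] (h : ∀ τ, ν₂ (Iio τ) ≤ ν₁ (Iio τ))
    {G : ℝ → ℝ} (hG : Antitone G) (hG0 : ∀ t, 0 ≤ G t) :
    ∫⁻ t, ENNReal.ofReal (G t) ∂ν₂ ≤ ∫⁻ t, ENNReal.ofReal (G t) ∂ν₁ := by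
  have hGm : Measurable G := hG.measurable
  rw [lintegral_eq_lintegral_meas_lt ν₂ (Eventually.of_forall hG0) hGm.aemeasurable,
    lintegral_eq_lintegral_meas_lt ν₁ (Eventually.of_forall hG0) hGm.aemeasurable]
  apply lintegral_mono
  intro s
  have hlow : IsLowerSet {t | s < G t} := by
    intro a b hab ha
    exact lt_of_lt_of_le ha (hG hab)
  simp only
  rcases fk_lower hlow with h0 | h0 | ⟨a, h0⟩ | ⟨a, h0⟩ <;> rw [h0]
  · simp
  · have e : (univ : Set ℝ) = ⋃ k : ℕ, Iio (k : ℝ) := by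
      ext x; simp only [mem_univ, mem_iUnion, mem_Iio, true_iff]; exact exists_nat_gt x
    have hm : Monotone fun k : ℕ => Iio (k : ℝ) := by
      intro j k hjk; exact Iio_subset_Iio (by exact_mod_cast hjk)
    rw [e, hm.measure_iUnion]
    apply iSup_le
    intro k
    exact (h _).trans (measure_mono (by rw [← e]; exact subset_univ _))
  · exact h a
  · have e : Iic a = ⋂ k : ℕ, Iio (a + 1 / ((k : ℝ) + 1)) := by
      ext x
      simp only [mem_Iic, mem_iInter, mem_Iio]
      constructor
      · intro hx k
        have : 0 < 1 / ((k : ℝ) + 1) := by positivity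
        linarith
      · intro hx
        by_contra hc
        obtain ⟨k, hk⟩ := exists_nat_one_div_lt (sub_pos.mpr (not_le.mp hc))
        have := hx k
        linarith
    have hm : Antitone fun k : ℕ => Iio (a + 1 / ((k : ℝ) + 1)) := by
      intro j k hjk
      apply Iio_subset_Iio
      gcongr
    have t := tendsto_measure_iInter_atTop (μ := ν₁) (s := fun k : ℕ => Iio (a + 1 / ((k : ℝ) + 1)))
      (fun k => (measurableSet_Iio (a := a + 1 / ((k : ℝ) + 1))).nullMeasurableSet) hm
      ⟨0, measure_ne_top _ _⟩
    rw [← e] at t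
    refine ge_of_tendsto' t fun k => ?_
    refine le_trans (measure_mono ?_) (h _)
    rw [e]
    exact iInter_subset _ k

section core
variable {n : ℕ}

lemma fk_layer_w {w φ : EuclideanSpace ℝ (Fin (n + 1)) → ℝ} (hw : Measurable w)
    (hw0 : ∀ x, 0 ≤ w x) (hφ : Measurable φ) (hφ0 : ∀ x, 0 ≤ φ x) :
    ∫⁻ x, ENNReal.ofReal (φ x * w x) = ∫⁻ t in Ioi (0:ℝ), ∫⁻ x in {x | t < w x}, ENNReal.ofReal (φ x) := by
  have h1 := lintegral_eq_lintegral_meas_lt (volume.withDensity fun x => ENNReal.ofReal (φ x))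
    (Eventually.of_forall hw0) hw.aemeasurable
  rw [lintegral_withDensity_eq_lintegral_mul _ (by fun_prop) (by fun_prop)] at h1
  have h2 : ∀ t : ℝ, (volume.withDensity fun x => ENNReal.ofReal (φ x)) {x | t < w x} =
      ∫⁻ x in {x | t < w x}, ENNReal.ofReal (φ x) := fun t =>
    withDensity_apply _ (measurableSet_lt measurable_const hw)
  simp_rw [h2] at h1
  rw [← h1]
  apply lintegral_congr
  intro x
  simp [ENNReal.ofReal_mul (hφ0 x)]

lemma fk_quantile {w : EuclideanSpace ℝ (Fin (n + 1)) → ℝ} (hw : Measurable w)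
    (hfin : ∀ t, 0 ≤ t → volume {x | t < w x} ≠ ⊤) {M : ℝ} (hM : ∀ x, w x ≤ M)
    {t : ℝ} (ht : 0 < t) {κ : ENNReal} (hκ : κ < volume {x | t < w x}) :
    κ ≤ volume {x | t < w x ∧ volume {y | w x < w y} ≤ κ} := by
  have hanti : ∀ {s s' : ℝ}, s ≤ s' → volume {x | s' < w x} ≤ volume {x | s < w x} := by
    intro s s' hs
    exact measure_mono fun x hx => lt_of_le_of_lt hs hx
  set T : Set ℝ := {τ | t ≤ τ ∧ volume {x | τ < w x} ≤ κ} with hT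
  have hne : T.Nonempty := by
    refine ⟨max t M, le_max_left _ _, ?_⟩
    have : {x | max t M < w x} = ∅ := by
      ext x; simp only [mem_ofPred_eq, mem_empty_iff_false, iff_false, not_lt]
      exact (hM x).trans (le_max_right _ _)
    rw [this]; simp
  have hbdd : BddBelow T := ⟨t, fun τ h => h.1⟩
  set t0 := sInf T with ht0
  have htt0 : t ≤ t0 := le_csInf hne fun τ h => h.1
  have ht0T : volume {x | t0 < w x} ≤ κ := by
    have e : {x | t0 < w x} = ⋃ k : ℕ, {x | t0 + 1 / ((k : ℝ) + 1) < w x} := by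
      ext x
      simp only [mem_ofPred_eq, mem_iUnion]
      constructor
      · intro hx
        obtain ⟨k, hk⟩ := exists_nat_one_div_lt (sub_pos.mpr hx)
        exact ⟨k, by linarith⟩
      · rintro ⟨k, hk⟩
        have : 0 < 1 / ((k : ℝ) + 1) := by positivity
        linarith
    have hm : Monotone fun k : ℕ => {x | t0 + 1 / ((k : ℝ) + 1) < w x} := by
      intro j k hjk x hx
      simp only [mem_ofPred_eq] at hx ⊢
      refine lt_of_le_of_lt ?_ hx
      gcongr
    rw [e, hm.measure_iUnion]
    apply iSup_le
    intro k
    have : t0 < t0 + 1 / ((k : ℝ) + 1) := by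
      have : 0 < 1 / ((k : ℝ) + 1) := by positivity
      linarith
    obtain ⟨τ, hτ, hlt⟩ := exists_lt_of_csInf_lt hne this
    exact (hanti hlt.le).trans hτ.2
  have hlt : t < t0 := by
    rcases htt0.eq_or_lt with h | h
    · rw [← h] at ht0T; exact absurd hκ (not_lt.mpr ht0T)
    · exact h
  have e : {x | t0 ≤ w x} = ⋂ k : ℕ, {x | t0 - (t0 - t) / ((k : ℝ) + 1) < w x} := by
    ext x
    simp only [mem_ofPred_eq, mem_iInter]
    constructor
    · intro hx k
      have : 0 < (t0 - t) / ((k : ℝ) + 1) := div_pos (sub_pos.mpr hlt) (by positivity)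
      linarith
    · intro hx
      by_contra hc
      have hc' : 0 < (t0 - w x) / (t0 - t) := div_pos (by linarith) (by linarith)
      obtain ⟨k, hk⟩ := exists_nat_one_div_lt hc'
      have := hx k
      rw [lt_div_iff₀ (by linarith)] at hk
      have e2 : (t0 - t) / ((k : ℝ) + 1) = 1 / ((k : ℝ) + 1) * (t0 - t) := by ring
      linarith
  have hm : Antitone fun k : ℕ => {x | t0 - (t0 - t) / ((k : ℝ) + 1) < w x} := by
    intro j k hjk x hx
    simp only [mem_ofPred_eq] at hx ⊢
    refine lt_of_le_of_lt ?_ hx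
    have : 0 < t0 - t := by linarith
    gcongr
  have hge : ∀ k : ℕ, t ≤ t0 - (t0 - t) / ((k : ℝ) + 1) := by
    intro k
    have : (t0 - t) / ((k : ℝ) + 1) ≤ t0 - t := div_le_self (by linarith) (by linarith [k.cast_nonneg (α := ℝ)])
    linarith
  have tend := tendsto_measure_iInter_atTop (μ := volume)
      (s := fun k : ℕ => {x | t0 - (t0 - t) / ((k : ℝ) + 1) < w x})
      (fun k => (measurableSet_lt measurable_const hw).nullMeasurableSet) hm
      ⟨0, hfin _ (ht.le.trans (hge 0))⟩
  rw [← e] at tend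
  refine le_trans (ge_of_tendsto' tend fun k => ?_) (measure_mono (s := {x | t0 ≤ w x}) ?_)
  · by_contra hc
    have hmem : t0 - (t0 - t) / ((k : ℝ) + 1) ∈ T := ⟨hge k, (not_le.mp hc).le⟩
    have h1 := csInf_le hbdd hmem
    have : 0 < (t0 - t) / ((k : ℝ) + 1) := div_pos (sub_pos.mpr hlt) (by positivity)
    linarith
  · intro x hx
    exact ⟨lt_of_lt_of_le hlt hx, (hanti hx).trans ht0T⟩

lemma fk_hardy {A : Set (EuclideanSpace ℝ (Fin (n + 1)))} (hA : MeasurableSet A) {ρ : ℝ}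
    (hv : volume A = volume (Metric.ball (0 : EuclideanSpace ℝ (Fin (n + 1))) ρ))
    {V : ℝ → ENNReal} (hV : Monotone V) :
    ∫⁻ x in Metric.ball (0 : EuclideanSpace ℝ (Fin (n + 1))) ρ, V ‖x‖ ≤ ∫⁻ x in A, V ‖x‖ := by
  set B := Metric.ball (0 : EuclideanSpace ℝ (Fin (n + 1))) ρ with hB
  have hBm : MeasurableSet B := Metric.isOpen_ball.measurableSet
  have hBf : volume B ≠ ⊤ := measure_ball_lt_top.ne
  have hdiff : volume (B \ A) = volume (A \ B) := by
    have h1 := measure_inter_add_sdiff (μ := volume) B hA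
    have h2 := measure_inter_add_sdiff (μ := volume) A hBm
    rw [inter_comm, hv, ← h1, inter_comm] at h2
    have hf : volume (A ∩ B) ≠ ⊤ := ((measure_mono inter_subset_right).trans_lt hBf.lt_top).ne
    exact ((ENNReal.add_right_inj hf).mp h2).symm
  rw [← lintegral_inter_add_sdiff _ B hA, ← lintegral_inter_add_sdiff _ A hBm, inter_comm]
  refine add_le_add_right ?_ _
  calc ∫⁻ x in B \ A, V ‖x‖ ≤ ∫⁻ x in B \ A, V ρ := by
        refine setLIntegral_mono' (hBm.diff hA) ?_
        intro x hx
        exact hV (by have := hx.1; rw [hB, mem_ball_zero_iff] at this; exact this.le)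
    _ = ∫⁻ x in A \ B, V ρ := by simp [hdiff]
    _ ≤ _ := by
        refine setLIntegral_mono' (hA.diff hBm) ?_
        intro x hx
        exact hV (by have := hx.2; rw [hB, mem_ball_zero_iff] at this; exact not_lt.mp this)

/-- radius of the superlevel set -/
noncomputable def fkρ (w : EuclideanSpace ℝ (Fin (n + 1)) → ℝ) (t : ℝ) : ℝ :=
  fkrad n (volume {x | max t 0 < w x})

lemma fkρ_eq (w : EuclideanSpace ℝ (Fin (n + 1)) → ℝ) {t : ℝ} (ht : 0 ≤ t) :
    fkρ w t = fkrad n (volume {x | t < w x}) := by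
  unfold fkρ; rw [max_eq_left ht]

lemma fkρ_anti {w : EuclideanSpace ℝ (Fin (n + 1)) → ℝ}
    (hfin : ∀ t, 0 ≤ t → volume {x | t < w x} ≠ ⊤) : Antitone (fkρ w) := by
  intro s t hst
  refine fkrad_mono n (measure_mono ?_) (hfin _ (le_max_right _ _))
  intro x hx
  exact lt_of_le_of_lt (max_le_max_right 0 hst) hx

lemma fk_step3 {w : EuclideanSpace ℝ (Fin (n + 1)) → ℝ} (hw : Measurable w) (hw0 : ∀ x, 0 ≤ w x)
    (hfin : ∀ t, 0 ≤ t → volume {x | t < w x} ≠ ⊤) {M : ℝ} (hM : ∀ x, w x ≤ M)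
    {H : ℝ → ℝ} (hH : Monotone H) (hH0 : ∀ s, 0 ≤ H s) {t : ℝ} (ht : 0 < t) :
    ∫⁻ x in {x | t < w x}, ENNReal.ofReal (H (fkρ w (w x))) ≤
      ∫⁻ x in Metric.ball (0 : EuclideanSpace ℝ (Fin (n + 1))) (fkρ w t), ENNReal.ofReal (H ‖x‖) := by
  have hρm : Measurable (fkρ w) := (fkρ_anti hfin).measurable
  have hAm : MeasurableSet {x | t < w x} := measurableSet_lt measurable_const hw
  set B := Metric.ball (0 : EuclideanSpace ℝ (Fin (n + 1))) (fkρ w t) with hB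
  have hvB : volume B = volume {x | t < w x} := by
    rw [hB, fkρ_eq w ht.le, fkrad_vol n (hfin t ht.le)]
  have hBf : volume B ≠ ⊤ := measure_ball_lt_top.ne
  have : IsFiniteMeasure (volume.restrict B) := ⟨by simpa using hBf.lt_top⟩
  set ν₂ := (volume.restrict {x | t < w x}).map (fun x => - fkρ w (w x)) with hν₂
  set ν₁ := (volume.restrict B).map (fun x => - ‖x‖) with hν₁
  have hm2 : Measurable fun x => - fkρ w (w x) := (hρm.comp hw).neg
  have hm1 : Measurable fun x : EuclideanSpace ℝ (Fin (n + 1)) => - ‖x‖ := by fun_prop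
  have hG : Antitone fun s => H (-s) := fun a b hab => hH (neg_le_neg hab)
  have key := fk_dom (ν₁ := ν₁) (ν₂ := ν₂) ?_ hG (fun s => hH0 _)
  · rw [hν₁, hν₂, lintegral_map (hG.measurable.ennreal_ofReal) hm2,
      lintegral_map (hG.measurable.ennreal_ofReal) hm1] at key
    simpa using key
  intro τ
  rw [hν₁, hν₂, Measure.map_apply hm2 measurableSet_Iio, Measure.map_apply hm1 measurableSet_Iio,
    Measure.restrict_apply (hm2 measurableSet_Iio), Measure.restrict_apply (hm1 measurableSet_Iio)]
  obtain ⟨σ, rfl⟩ : ∃ σ, τ = -σ := ⟨-τ, by simp⟩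
  rcases lt_or_ge σ 0 with hσ | hσ
  · refine le_trans (measure_mono inter_subset_right) (hvB.symm.le.trans (measure_mono ?_))
    intro x hx
    refine ⟨?_, hx⟩
    simp only [mem_preimage, mem_Iio, neg_lt_neg_iff]
    exact hσ.trans_le (norm_nonneg x)
  rcases le_or_gt (fkρ w t) σ with hσ' | hσ'
  · have : (fun x => - fkρ w (w x)) ⁻¹' Iio (-σ) ∩ {x | t < w x} = ∅ := by
      ext x
      simp only [mem_inter_iff, mem_preimage, mem_Iio, neg_lt_neg_iff, mem_ofPred_eq,
        mem_empty_iff_false, iff_false, not_and, not_lt]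
      intro h1
      by_contra hc
      exact absurd (fkρ_anti hfin (not_le.mp hc).le) (not_le.mpr (hσ'.trans_lt h1))
    rw [this]; simp
  set κ := volume (Metric.ball (0 : EuclideanSpace ℝ (Fin (n + 1))) σ) with hκ
  have hκf : κ ≠ ⊤ := measure_ball_lt_top.ne
  have hωp := fkω_pos n
  have hiff : ∀ s, 0 ≤ s → (volume {x | s < w x} ≤ κ → fkρ w s ≤ σ) := by
    intro s hs hle
    rw [fkρ_eq w hs]
    by_contra hc
    rw [← fkrad_vol n (hfin s hs), hκ, fk_vol_ball n (fkrad_nonneg _ _), fk_vol_ball n hσ,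
      ENNReal.ofReal_le_ofReal_iff (by positivity)] at hle
    have := pow_lt_pow_left₀ (not_le.mp hc) hσ (n := n + 1) (by omega)
    nlinarith
  have hκlt : κ < volume {x | t < w x} := by
    rw [← hvB, hκ, hB, fk_vol_ball n hσ, fk_vol_ball n (hσ.trans hσ'.le)]
    rw [ENNReal.ofReal_lt_ofReal_iff_of_nonneg (by positivity)]
    have := pow_lt_pow_left₀ hσ' hσ (n := n + 1) (by omega)
    gcongr
  have hq := fk_quantile hw hfin hM ht hκlt
  refine (ENNReal.add_le_add_iff_left hκf).mp ?_
  have hPm : MeasurableSet ((fun x => - fkρ w (w x)) ⁻¹' Iio (-σ)) := hm2 measurableSet_Iio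
  calc κ + volume ((fun x => - fkρ w (w x)) ⁻¹' Iio (-σ) ∩ {x | t < w x})
      ≤ volume ({x | t < w x} \ (fun x => - fkρ w (w x)) ⁻¹' Iio (-σ))
        + volume ((fun x => - fkρ w (w x)) ⁻¹' Iio (-σ) ∩ {x | t < w x}) := by
        gcongr
        refine hq.trans (measure_mono ?_)
        rintro x ⟨hx1, hx2⟩
        refine ⟨hx1, ?_⟩
        simp only [mem_preimage, mem_Iio, neg_lt_neg_iff, not_lt]
        exact hiff _ (hw0 x) hx2
    _ = volume {x | t < w x} := by
        rw [inter_comm, add_comm, measure_inter_add_sdiff _ hPm]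
    _ = volume B := hvB.symm
    _ ≤ volume (Metric.closedBall (0 : EuclideanSpace ℝ (Fin (n + 1))) σ) +
        volume ((fun x => - ‖x‖) ⁻¹' Iio (-σ) ∩ B) := by
        refine le_trans (measure_mono ?_) (measure_union_le _ _)
        intro x hx
        by_cases h : ‖x‖ ≤ σ
        · left; simpa using h
        · right; exact ⟨by simpa using h, hx⟩
    _ = κ + volume ((fun x => - ‖x‖) ⁻¹' Iio (-σ) ∩ B) := by
        rw [hκ, Measure.addHaar_closedBall_eq_addHaar_ball]

lemma fk_step1 (hn : 1 ≤ n) {w : EuclideanSpace ℝ (Fin (n + 1)) → ℝ} (hw : ContDiff ℝ 2 w)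
    (hc : HasCompactSupport w) (hw0 : ∀ x, 0 ≤ w x)
    (hfin : ∀ t, 0 ≤ t → volume {x | t < w x} ≠ ⊤)
    {h : ℝ → ℝ} (hh : Monotone h) (hh0 : ∀ s, 0 ≤ h s) :
    ∫⁻ t in Ioi (0:ℝ), ENNReal.ofReal ((n + 1) * fkω n * fkρ w t ^ n * h (fkρ w t)) ≤
      ∫⁻ x, ENNReal.ofReal (‖fderiv ℝ w x‖ * h (fkρ w (w x))) := by
  have hρm : Measurable (fkρ w) := (fkρ_anti hfin).measurable
  have hwc : Continuous w := hw.continuous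
  have hdc : Continuous (fun x => ‖fderiv ℝ w x‖) := (hw.continuous_fderiv (by norm_num)).norm
  have hωp := fkω_pos n
  have hρ0 : ∀ t, 0 ≤ fkρ w t := fun t => fkrad_nonneg _ _
  set ν₂ := (volume.restrict (Ioi (0:ℝ))).withDensity
    (fun t => ENNReal.ofReal ((n + 1) * fkω n * fkρ w t ^ n)) with hν₂
  set ν₀ := (volume : Measure (EuclideanSpace ℝ (Fin (n + 1)))).withDensity
    (fun x => ENNReal.ofReal ‖fderiv ℝ w x‖) with hν₀
  have hint : Integrable (fun x => ‖fderiv ℝ w x‖) :=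
    hdc.integrable_of_hasCompactSupport (hc.fderiv ℝ).norm
  have : IsFiniteMeasure ν₀ := isFiniteMeasure_withDensity_ofReal hint.2
  have hG : Antitone fun t => h (fkρ w t) := hh.comp_antitone (fkρ_anti hfin)
  have key := fk_dom (ν₁ := ν₀.map w) (ν₂ := ν₂) ?_ hG (fun s => hh0 _)
  · have hGw : Measurable fun x => ENNReal.ofReal (h (fkρ w (w x))) :=
      hG.measurable.ennreal_ofReal.comp hwc.measurable
    rw [lintegral_map (hG.measurable.ennreal_ofReal) hwc.measurable, hν₂, hν₀,
      lintegral_withDensity_eq_lintegral_mul _ (by fun_prop) (hG.measurable.ennreal_ofReal),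
      lintegral_withDensity_eq_lintegral_mul _ hdc.measurable.ennreal_ofReal hGw] at key
    convert key using 1
    · apply lintegral_congr
      intro t
      have := hρ0 t
      simp only [Pi.mul_apply]
      rw [ENNReal.ofReal_mul (by positivity)]
    · apply lintegral_congr
      intro x
      simp only [Pi.mul_apply]
      rw [ENNReal.ofReal_mul (by positivity)]
  intro τ
  rw [Measure.map_apply hwc.measurable measurableSet_Iio, hν₂, hν₀,
    withDensity_apply _ measurableSet_Iio, withDensity_apply _ (hwc.measurable measurableSet_Iio),
    Measure.restrict_restrict measurableSet_Iio]
  have e : Iio τ ∩ Ioi 0 = Ioo 0 τ := by rw [inter_comm]; rfl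
  rw [e]
  rcases le_or_gt τ 0 with hτ | hτ
  · rw [Ioo_eq_empty (not_lt.mpr hτ)]; simp
  refine le_trans (le_of_eq ?_) (fk_iso hn hw hc hw0 hτ)
  refine setLIntegral_congr_fun measurableSet_Ioo ?_
  intro t ht
  simp only
  rw [fkρ_eq w ht.1.le]

lemma fk_core (hn : 1 ≤ n) {w : EuclideanSpace ℝ (Fin (n + 1)) → ℝ} (hw : ContDiff ℝ 2 w)
    (hc : HasCompactSupport w) (hw0 : ∀ x, 0 ≤ w x)
    {h V : ℝ → ℝ} (hh : Monotone h) (hh0 : ∀ s, 0 ≤ h s) (hV : Monotone V) (hV0 : ∀ s, 0 ≤ V s)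
    {r μ : ℝ} (hr : 0 ≤ r)
    (hvol : volume {x | 0 < w x} ≤ volume (Metric.ball (0 : EuclideanSpace ℝ (Fin (n + 1))) r))
    (hid : ∀ ρ, 0 ≤ ρ → ρ ≤ r → ENNReal.ofReal ((n + 1) * fkω n * ρ ^ n * h ρ) +
      ∫⁻ x in Metric.ball (0 : EuclideanSpace ℝ (Fin (n + 1))) ρ, ENNReal.ofReal (V ‖x‖) =
      ENNReal.ofReal μ * volume (Metric.ball (0 : EuclideanSpace ℝ (Fin (n + 1))) ρ) +
      ∫⁻ x in Metric.ball (0 : EuclideanSpace ℝ (Fin (n + 1))) ρ, ENNReal.ofReal (h ‖x‖ ^ 2)) :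
    ENNReal.ofReal μ * (∫⁻ x, ENNReal.ofReal (w x)) +
      ∫⁻ x, ENNReal.ofReal (h (fkρ w (w x)) ^ 2 * w x) ≤
      (∫⁻ x, ENNReal.ofReal (‖fderiv ℝ w x‖ * h (fkρ w (w x)))) +
        ∫⁻ x, ENNReal.ofReal (V ‖x‖ * w x) := by
  have hwc : Continuous w := hw.continuous
  have hwm := hwc.measurable
  have hfin : ∀ t, 0 ≤ t → volume {x | t < w x} ≠ ⊤ := by
    intro t ht
    refine (lt_of_le_of_lt (measure_mono ?_) hc.isCompact.measure_lt_top).ne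
    intro x hx
    apply subset_tsupport
    simp only [mem_ofPred_eq] at hx
    simp only [Function.mem_support]; linarith
  obtain ⟨M, hM⟩ : ∃ M, ∀ x, w x ≤ M := by
    obtain ⟨M, hM⟩ := hc.exists_bound_of_continuous hwc
    exact ⟨M, fun x => (le_abs_self _).trans (hM x)⟩
  have hanti := fkρ_anti hfin
  have hρm : Measurable (fkρ w) := hanti.measurable
  have hρr : ∀ t, 0 ≤ t → fkρ w t ≤ r := by
    intro t ht
    have h1 : fkρ w t ≤ fkρ w 0 := hanti ht
    refine h1.trans ?_
    rw [fkρ_eq w le_rfl]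
    by_contra hcon
    rw [← fkrad_vol n (hfin 0 le_rfl), fk_vol_ball n (fkrad_nonneg _ _), fk_vol_ball n hr,
      ENNReal.ofReal_le_ofReal_iff (by have := fkω_pos n; positivity)] at hvol
    have := pow_lt_pow_left₀ (not_le.mp hcon) hr (n := n + 1) (by omega)
    have := fkω_pos n
    nlinarith
  have hH : Monotone fun s => h s ^ 2 := fun a b hab => pow_le_pow_left₀ (hh0 a) (hh hab) 2
  have s3 : ∫⁻ x, ENNReal.ofReal (h (fkρ w (w x)) ^ 2 * w x) ≤
      ∫⁻ t in Ioi (0:ℝ), ∫⁻ x in Metric.ball (0 : EuclideanSpace ℝ (Fin (n + 1))) (fkρ w t),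
        ENNReal.ofReal (h ‖x‖ ^ 2) := by
    rw [fk_layer_w (φ := fun x => h (fkρ w (w x)) ^ 2) hwm hw0 ((hH.measurable.comp hρm).comp hwm)
      (fun x => sq_nonneg _)]
    refine setLIntegral_mono' measurableSet_Ioi fun t ht => ?_
    exact fk_step3 hwm hw0 hfin hM hH (fun s => sq_nonneg _) ht
  have s4 : ∫⁻ t in Ioi (0:ℝ), ∫⁻ x in Metric.ball (0 : EuclideanSpace ℝ (Fin (n + 1))) (fkρ w t),
        ENNReal.ofReal (V ‖x‖) ≤ ∫⁻ x, ENNReal.ofReal (V ‖x‖ * w x) := by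
    rw [fk_layer_w (φ := fun x => V ‖x‖) hwm hw0 (hV.measurable.comp measurable_norm) (fun x => hV0 _)]
    refine setLIntegral_mono' measurableSet_Ioi fun t ht => ?_
    refine fk_hardy (V := fun s => ENNReal.ofReal (V s)) (measurableSet_lt measurable_const hwm) ?_
      (fun a b hab => ENNReal.ofReal_le_ofReal (hV hab))
    rw [fkρ_eq w (le_of_lt ht), fkrad_vol n (hfin t (le_of_lt ht))]
  have s5 : ∫⁻ x, ENNReal.ofReal (w x) = ∫⁻ t in Ioi (0:ℝ),
      volume (Metric.ball (0 : EuclideanSpace ℝ (Fin (n + 1))) (fkρ w t)) := by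
    rw [lintegral_eq_lintegral_meas_lt volume (Eventually.of_forall hw0) hwm.aemeasurable]
    refine setLIntegral_congr_fun measurableSet_Ioi fun t ht => ?_
    change volume {x | t < w x} = volume (Metric.ball (0 : EuclideanSpace ℝ (Fin (n + 1))) (fkρ w t))
    rw [fkρ_eq w (le_of_lt ht), fkrad_vol n (hfin t (le_of_lt ht))]
  have s1 := fk_step1 hn hw hc hw0 hfin hh hh0
  have mvol : Measurable fun t => volume (Metric.ball (0 : EuclideanSpace ℝ (Fin (n + 1))) (fkρ w t)) := by
    apply Antitone.measurable
    intro a b hab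
    exact measure_mono (Metric.ball_subset_ball (hanti hab))
  calc _ ≤ ENNReal.ofReal μ * (∫⁻ t in Ioi (0:ℝ),
      volume (Metric.ball (0 : EuclideanSpace ℝ (Fin (n + 1))) (fkρ w t))) +
      ∫⁻ t in Ioi (0:ℝ), ∫⁻ x in Metric.ball (0 : EuclideanSpace ℝ (Fin (n + 1))) (fkρ w t),
        ENNReal.ofReal (h ‖x‖ ^ 2) := by rw [s5]; gcongr
    _ = (∫⁻ t in Ioi (0:ℝ), ENNReal.ofReal ((n + 1) * fkω n * fkρ w t ^ n * h (fkρ w t))) +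
        ∫⁻ t in Ioi (0:ℝ), ∫⁻ x in Metric.ball (0 : EuclideanSpace ℝ (Fin (n + 1))) (fkρ w t),
        ENNReal.ofReal (V ‖x‖) := by
        have hhm := hh.measurable
        rw [← lintegral_const_mul _ mvol, ← lintegral_add_left (mvol.const_mul _),
          ← lintegral_add_left (by fun_prop)]
        refine setLIntegral_congr_fun measurableSet_Ioi fun t ht => ?_
        exact (hid _ (fkrad_nonneg _ _) (hρr t (le_of_lt ht))).symm
    _ ≤ _ := add_le_add s1 s4

end core

def fkA (a : ℕ → ℝ) : Prop := ∃ C K : ℝ, 0 ≤ C ∧ 0 ≤ K ∧ ∀ k, |a k| ≤ C * K ^ k / (k.factorial : ℝ)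

noncomputable def fkF (a : ℕ → ℝ) (z : ℝ) : ℝ := ∑' k, a k * z ^ k

def fkD (a : ℕ → ℝ) : ℕ → ℝ := fun k => (k + 1) * a (k + 1)

lemma fkA_D {a : ℕ → ℝ} (h : fkA a) : fkA (fkD a) := by
  obtain ⟨C, K, hC, hK, hb⟩ := h
  refine ⟨C * K, K, by positivity, hK, fun k => ?_⟩
  have h1 := hb (k + 1)
  rw [fkD, abs_mul, abs_of_nonneg (by positivity : (0:ℝ) ≤ k + 1)]
  calc ((k:ℝ) + 1) * |a (k + 1)| ≤ (k + 1) * (C * K ^ (k + 1) / ((k + 1).factorial : ℝ)) := by gcongr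
    _ = _ := by
      rw [Nat.factorial_succ]; push_cast
      have : (k.factorial : ℝ) ≠ 0 := by positivity
      field_simp
      ring

lemma fkA_summable {a : ℕ → ℝ} (h : fkA a) (z : ℝ) : Summable fun k => a k * z ^ k := by
  obtain ⟨C, K, hC, hK, hb⟩ := h
  refine Summable.of_norm_bounded (g := fun k : ℕ => C * ((K * |z|) ^ k / (k.factorial : ℝ)))
    ((Real.summable_pow_div_factorial _).mul_left C) fun k => ?_
  rw [Real.norm_eq_abs, abs_mul, abs_pow]
  calc |a k| * |z| ^ k ≤ (C * K ^ k / (k.factorial : ℝ)) * |z| ^ k := by gcongr; exact hb k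
    _ = _ := by rw [mul_pow]; ring

lemma fkF_hasDerivAt {a : ℕ → ℝ} (h : fkA a) (z : ℝ) : HasDerivAt (fkF a) (fkF (fkD a) z) z := by
  have h' := h
  obtain ⟨C, K, hC, hK, hb⟩ := h
  set ρ := |z| + 1 with hρ
  have hρ0 : 0 ≤ ρ := by positivity
  have key : HasDerivAt (fun z => ∑' k, a k * z ^ k) (∑' k, a k * (k * z ^ (k - 1))) z := by
    refine hasDerivAt_tsum_of_isPreconnected (𝕜 := ℝ) (g := fun k z => a k * z ^ k)
      (g' := fun k z => a k * (k * z ^ (k - 1))) (y := z)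
      (u := fun k : ℕ => C * K ^ k / (k.factorial : ℝ) * (k * ρ ^ (k - 1)))
      (t := Metric.ball 0 ρ) (y₀ := 0) ?_ Metric.isOpen_ball
      (convex_ball _ _).isPreconnected ?_ ?_ (Metric.mem_ball_self (by positivity))
      (fkA_summable h' 0) (by rw [mem_ball_zero_iff, Real.norm_eq_abs]; linarith)
    · rw [← summable_nat_add_iff 1]
      refine (((Real.summable_pow_div_factorial (K * ρ)).mul_left (C * K))).congr fun k => ?_
      rw [Nat.factorial_succ]; push_cast
      have : (k.factorial : ℝ) ≠ 0 := by positivity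
      field_simp
      rw [mul_pow, pow_succ]; ring
    · intro k y hy
      exact (hasDerivAt_pow k y).const_mul (a k)
    · intro k y hy
      rw [mem_ball_zero_iff, Real.norm_eq_abs] at hy
      rw [Real.norm_eq_abs, abs_mul, abs_mul, abs_pow, Nat.abs_cast]
      gcongr
      exact hb k
  have e : (∑' k, a k * ((k:ℝ) * z ^ (k - 1))) = fkF (fkD a) z := by
    have hs : Summable fun k : ℕ => a (k + 1) * (((k + 1 : ℕ) : ℝ) * z ^ (k + 1 - 1)) := by
      refine (fkA_summable (fkA_D h') z).congr fun k => ?_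
      simp only [fkD, Nat.add_sub_cancel]; push_cast; ring
    have hs' := (summable_nat_add_iff (f := fun k : ℕ => a k * ((k:ℝ) * z ^ (k - 1))) 1).mp hs
    rw [hs'.tsum_eq_zero_add]
    simp only [fkF, Nat.cast_zero, zero_mul, mul_zero, zero_add]
    refine tsum_congr fun k => ?_
    simp only [fkD, Nat.add_sub_cancel]; push_cast; ring
  rw [e] at key
  exact key

lemma fkF_contDiff {a : ℕ → ℝ} (h : fkA a) : ContDiff ℝ (⊤ : ℕ∞) (fkF a) := by
  have : ∀ m : ℕ, ∀ a, fkA a → ContDiff ℝ m (fkF a) := by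
    intro m
    induction m with
    | zero =>
      intro a h
      exact contDiff_zero.mpr (continuous_iff_continuousAt.mpr fun z => (fkF_hasDerivAt h z).continuousAt)
    | succ m ih =>
      intro a h
      push_cast
      rw [contDiff_succ_iff_deriv]
      refine ⟨fun z => (fkF_hasDerivAt h z).differentiableAt, by simp, ?_⟩
      have : deriv (fkF a) = fkF (fkD a) := funext fun z => (fkF_hasDerivAt h z).deriv
      rw [this]
      exact ih _ (fkA_D h)
  exact contDiff_infty.mpr fun m => this m a h

lemma fkF_mul {a : ℕ → ℝ} (h : fkA a) (z : ℝ) :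
    HasSum (fun k : ℕ => (k * a k) * z ^ k) (z * fkF (fkD a) z) := by
  have hs := (fkA_summable (fkA_D h) z).hasSum.mul_left z
  rw [← hasSum_nat_add_iff' 1]
  have e1 : (fun k : ℕ => (((k + 1 : ℕ) : ℝ) * a (k + 1)) * z ^ (k + 1)) = fun i => z * (fkD a i * z ^ i) := by
    ext k
    simp only [fkD]; push_cast; ring
  have e2 : z * fkF (fkD a) z - ∑ i ∈ Finset.range 1, ((i:ℝ) * a i) * z ^ i = z * ∑' (b : ℕ), fkD a b * z ^ b := by
    simp [fkF]
  rw [e2]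
  exact e1 ▸ hs

noncomputable def fkb (n : ℕ) (c ν : ℝ) : ℕ → ℝ
  | 0 => 1
  | k + 1 => (4 * c * k - ν) / ((2 * k + 2) * (2 * k + (n + 1))) * fkb n c ν k

lemma fkb_bound (n : ℕ) {c : ℝ} (hc : 0 < c) {ν A : ℝ} (hA : |ν| ≤ A) (k : ℕ) :
    |fkb n c ν k| ≤ 1 * ((2 * c + A) / 2) ^ k / (k.factorial : ℝ) := by
  have hA0 : 0 ≤ A := (abs_nonneg _).trans hA
  induction k with
  | zero => simp [fkb]
  | succ k ih =>
    have h1 : |4 * c * k - ν| ≤ (2 * c + A) * (2 * k + (n + 1)) := by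
      calc |4 * c * k - ν| ≤ |4 * c * k| + |ν| := abs_sub _ _
        _ ≤ 4 * c * k + A := by rw [abs_of_nonneg (by positivity)]; gcongr
        _ ≤ _ := by
          have : (0:ℝ) ≤ n := by positivity
          have : (0:ℝ) ≤ k := by positivity
          nlinarith [mul_nonneg hA0 this, mul_nonneg hA0 (Nat.cast_nonneg (α := ℝ) n), mul_nonneg hc.le (Nat.cast_nonneg (α := ℝ) n)]
    rw [fkb, abs_mul, abs_div, abs_of_pos (by positivity : (0:ℝ) < (2 * k + 2) * (2 * k + (n + 1)))]
    calc _ ≤ ((2 * c + A) * (2 * k + (n + 1))) / ((2 * k + 2) * (2 * k + (n + 1))) *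
          (1 * ((2 * c + A) / 2) ^ k / (k.factorial : ℝ)) := by gcongr
      _ = _ := by
        rw [Nat.factorial_succ]; push_cast
        have : (k.factorial : ℝ) ≠ 0 := by positivity
        field_simp
        ring

lemma fkb_A (n : ℕ) {c : ℝ} (hc : 0 < c) (ν : ℝ) : fkA (fkb n c ν) :=
  ⟨1, (2 * c + |ν|) / 2, by positivity, by positivity, fkb_bound n hc le_rfl⟩

noncomputable def fkY (n : ℕ) (c ν : ℝ) : ℝ → ℝ := fkF (fkb n c ν)
noncomputable def fkY1 (n : ℕ) (c ν : ℝ) : ℝ → ℝ := fkF (fkD (fkb n c ν))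
noncomputable def fkY2 (n : ℕ) (c ν : ℝ) : ℝ → ℝ := fkF (fkD (fkD (fkb n c ν)))
noncomputable def fkY3 (n : ℕ) (c ν : ℝ) : ℝ → ℝ := fkF (fkD (fkD (fkD (fkb n c ν))))

section ode
variable (n : ℕ) {c : ℝ} (hc : 0 < c) (ν : ℝ)

lemma fkY_deriv (hc : 0 < c) (z : ℝ) : HasDerivAt (fkY n c ν) (fkY1 n c ν z) z := fkF_hasDerivAt (fkb_A n hc ν) z
lemma fkY1_deriv (hc : 0 < c) (z : ℝ) : HasDerivAt (fkY1 n c ν) (fkY2 n c ν z) z :=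
  fkF_hasDerivAt (fkA_D (fkb_A n hc ν)) z
lemma fkY2_deriv (hc : 0 < c) (z : ℝ) : HasDerivAt (fkY2 n c ν) (fkY3 n c ν z) z :=
  fkF_hasDerivAt (fkA_D (fkA_D (fkb_A n hc ν))) z

lemma fkY_contDiff (hc : 0 < c) : ContDiff ℝ (⊤ : ℕ∞) (fkY n c ν) := fkF_contDiff (fkb_A n hc ν)
lemma fkY1_contDiff (hc : 0 < c) : ContDiff ℝ (⊤ : ℕ∞) (fkY1 n c ν) := fkF_contDiff (fkA_D (fkb_A n hc ν))
lemma fkY2_contDiff (hc : 0 < c) : ContDiff ℝ (⊤ : ℕ∞) (fkY2 n c ν) := fkF_contDiff (fkA_D (fkA_D (fkb_A n hc ν)))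

lemma fkY_zero : fkY n c ν 0 = 1 := by
  rw [fkY, fkF, tsum_eq_single 0]
  · simp [fkb]
  · intro k hk; simp [hk]

lemma fkY_ode (hc : 0 < c) (z : ℝ) : 4 * z * fkY2 n c ν z + 2 * (n + 1) * fkY1 n c ν z
    - 4 * c * z * fkY1 n c ν z + ν * fkY n c ν z = 0 := by
  have hA := fkb_A n hc ν
  have h0 := (fkA_summable hA z).hasSum.mul_left ν
  have h1 := (fkA_summable (fkA_D hA) z).hasSum.mul_left (2 * ((n:ℝ) + 1))
  have h2 := (fkF_mul (fkA_D hA) z).mul_left 4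
  have h3 := (fkF_mul hA z).mul_left (4 * c)
  have h := ((h2.add h1).sub h3).add h0
  have h' : HasSum (fun _ : ℕ => (0:ℝ)) 0 := hasSum_zero
  have := h.unique (h'.congr_fun ?_)
  · rw [← this]; simp only [fkY, fkY1, fkY2, fkF]; ring
  · intro k
    have e : fkb n c ν (k + 1) * ((2 * k + 2) * (2 * k + (n + 1))) = (4 * c * k - ν) * fkb n c ν k := by
      rw [fkb]; field_simp
    simp only [fkD]
    linear_combination (z^k) * e

lemma fkY_ode' (hc : 0 < c) (z : ℝ) : 4 * z * fkY3 n c ν z + (4 + 2 * (n + 1) - 4 * c * z) * fkY2 n c ν z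
    + (ν - 4 * c) * fkY1 n c ν z = 0 := by
  have h2 := fkY2_deriv n ν hc z
  have h1 := fkY1_deriv n ν hc z
  have h0 := fkY_deriv n ν hc z
  have h := ((((hasDerivAt_id z).const_mul 4).mul h2).add (h1.const_mul (2 * ((n:ℝ) + 1)))).sub
    (((hasDerivAt_id z).const_mul (4 * c)).mul h1) |>.add (h0.const_mul ν)
  have e := h.unique ((hasDerivAt_const z (0:ℝ)).congr_of_eventuallyEq
    (Eventually.of_forall fun z => by
      have := fkY_ode n ν hc z
      simp only [Pi.add_apply, Pi.sub_apply, Pi.mul_apply, id]; exact this))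
  simp only [id] at e
  linear_combination e

end ode

lemma fkY_joint (n : ℕ) {c : ℝ} (hc : 0 < c) : Continuous fun p : ℝ × ℝ => fkY n c p.1 p.2 := by
  have hb : ∀ k, Continuous fun p : ℝ × ℝ => fkb n c p.1 k := by
    intro k
    induction k with
    | zero => simp only [fkb]; exact continuous_const
    | succ k ih => simp only [fkb]; fun_prop
  rw [continuous_iff_continuousAt]
  intro p
  set A := |p.1| + 1
  set Z := |p.2| + 1
  have hO : {q : ℝ × ℝ | |q.1| < A ∧ |q.2| < Z} ∈ nhds p := by
    apply IsOpen.mem_nhds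
    · exact (isOpen_lt (f := fun q : ℝ × ℝ => |q.1|) (by fun_prop) continuous_const).inter
        (isOpen_lt (f := fun q : ℝ × ℝ => |q.2|) (by fun_prop) continuous_const)
    · exact ⟨by simp [A], by simp [Z]⟩
  refine ContinuousOn.continuousAt ?_ hO
  have hA : 0 ≤ A := by positivity
  have hZ : 0 ≤ Z := by positivity
  refine continuousOn_tsum (u := fun k : ℕ => ((2 * c + A) / 2 * Z) ^ k / (k.factorial : ℝ)) ?_
    (Real.summable_pow_div_factorial _) ?_
  · intro k
    exact ((hb k).mul (by fun_prop)).continuousOn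
  · intro k q hq
    rw [Real.norm_eq_abs, abs_mul, abs_pow]
    calc _ ≤ (1 * ((2 * c + A) / 2) ^ k / (k.factorial : ℝ)) * Z ^ k := by
          gcongr
          · exact fkb_bound n hc hq.1.le k
          · exact hq.2.le
      _ = _ := by rw [mul_pow]; ring

section hfun
variable (n : ℕ) {c : ℝ} (ν : ℝ)

lemma fkF1_deriv (hc : 0 < c) (s : ℝ) :
    HasDerivAt (fun s => s ^ (n + 1) * Real.exp (-(c * s ^ 2)) * fkY1 n c ν (s ^ 2))
      (s ^ n * Real.exp (-(c * s ^ 2)) * (-(ν / 2) * fkY n c ν (s ^ 2))) s := by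
  have h1 := (fkY1_deriv n ν hc (s ^ 2)).comp s (hasDerivAt_pow 2 s)
  have h2 := ((hasDerivAt_pow 2 s).const_mul c).neg.exp
  have h3 := ((hasDerivAt_pow (n + 1) s).mul h2).mul h1
  have o := fkY_ode n ν hc (s ^ 2)
  refine HasDerivAt.congr_deriv h3 ?_
  simp only [Nat.add_sub_cancel, Function.comp, Pi.mul_apply]
  push_cast
  linear_combination ((s ^ n) * Real.exp (-(c * s ^ 2)) / 2) * o

lemma fkY1_nonpos (hc : 0 < c) (hν : 0 ≤ ν) {r : ℝ} (hY : ∀ s, 0 ≤ s → s ≤ r → 0 ≤ fkY n c ν (s ^ 2))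
    {s : ℝ} (hs : 0 ≤ s) (hsr : s ≤ r) : fkY1 n c ν (s ^ 2) ≤ 0 := by
  rcases hs.eq_or_lt with rfl | hs0
  · have o := fkY_ode n ν hc 0
    rw [fkY_zero] at o
    have : (0:ℝ) ≤ n := by positivity
    norm_num at o ⊢
    nlinarith
  have hanti : AntitoneOn (fun s => s ^ (n + 1) * Real.exp (-(c * s ^ 2)) * fkY1 n c ν (s ^ 2)) (Icc 0 r) := by
    refine antitoneOn_of_deriv_nonpos (convex_Icc 0 r)
      (fun x _ => (fkF1_deriv n ν hc x).continuousAt.continuousWithinAt)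
      (fun x _ => (fkF1_deriv n ν hc x).differentiableAt.differentiableWithinAt) ?_
    intro x hx
    rw [interior_Icc] at hx
    rw [(fkF1_deriv n ν hc x).deriv]
    have h0 := hY x hx.1.le hx.2.le
    have h1 : 0 ≤ x ^ n := pow_nonneg hx.1.le n
    have h2 := Real.exp_pos (-(c * x ^ 2))
    have : 0 ≤ x ^ n * Real.exp (-(c * x ^ 2)) * (ν / 2 * fkY n c ν (x ^ 2)) := by positivity
    linarith
  have := hanti (left_mem_Icc.mpr (hs.trans hsr)) ⟨hs, hsr⟩ hs
  simp only [ne_eq, Nat.add_eq_zero_iff, one_ne_zero, and_false, not_false_eq_true, zero_pow, zero_mul] at this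
  exact nonpos_of_mul_nonpos_right this (by positivity)

lemma fkY1_neg (hc : 0 < c) (hν : 0 < ν) {r : ℝ} (hr : 0 < r) (hY : ∀ s, 0 ≤ s → s < r → 0 < fkY n c ν (s ^ 2)) :
    fkY1 n c ν (r ^ 2) < 0 := by
  have hanti : StrictAntiOn (fun s => s ^ (n + 1) * Real.exp (-(c * s ^ 2)) * fkY1 n c ν (s ^ 2)) (Icc 0 r) := by
    refine strictAntiOn_of_deriv_neg (convex_Icc 0 r)
      (fun x _ => (fkF1_deriv n ν hc x).continuousAt.continuousWithinAt) ?_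
    intro x hx
    rw [interior_Icc] at hx
    rw [(fkF1_deriv n ν hc x).deriv]
    have h0 := hY x hx.1.le hx.2
    have h1 : 0 < x ^ n := pow_pos hx.1 n
    have h2 := Real.exp_pos (-(c * x ^ 2))
    have : 0 < x ^ n * Real.exp (-(c * x ^ 2)) * (ν / 2 * fkY n c ν (x ^ 2)) := by positivity
    linarith
  have := hanti (left_mem_Icc.mpr hr.le) (right_mem_Icc.mpr hr.le) hr
  simp only [ne_eq, Nat.add_eq_zero_iff, one_ne_zero, and_false, not_false_eq_true, zero_pow, zero_mul] at this
  by_contra hcon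
  have : 0 ≤ r ^ (n + 1) * Real.exp (-(c * r ^ 2)) * fkY1 n c ν (r ^ 2) :=
    mul_nonneg (by positivity) (not_lt.mp hcon)
  linarith

noncomputable def fkW (n : ℕ) (c ν z : ℝ) : ℝ := fkY1 n c ν z ^ 2 - fkY n c ν z * fkY2 n c ν z

lemma fkW_deriv (hc : 0 < c) (s : ℝ) :
    HasDerivAt (fun s => s ^ (n + 3) * Real.exp (-(c * s ^ 2)) * fkW n c ν (s ^ 2))
      (2 * (s ^ (n + 2) * Real.exp (-(c * s ^ 2))) *
        (fkY1 n c ν (s ^ 2) ^ 2 - c * fkY n c ν (s ^ 2) * fkY1 n c ν (s ^ 2))) s := by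
  have h0 := (fkY_deriv n ν hc (s ^ 2)).comp s (hasDerivAt_pow 2 s)
  have h1 := (fkY1_deriv n ν hc (s ^ 2)).comp s (hasDerivAt_pow 2 s)
  have h1' := (fkY2_deriv n ν hc (s ^ 2)).comp s (hasDerivAt_pow 2 s)
  have h2 := ((hasDerivAt_pow 2 s).const_mul c).neg.exp
  have h3 := ((hasDerivAt_pow (n + 3) s).mul h2).mul ((h1.pow 2).sub (h0.mul h1'))
  have o := fkY_ode n ν hc (s ^ 2)
  have o' := fkY_ode' n ν hc (s ^ 2)
  refine HasDerivAt.congr_deriv h3 ?_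
  simp only [Function.comp, Pi.mul_apply, Pi.sub_apply, Pi.pow_apply, Pi.neg_apply]
  push_cast
  linear_combination ((s ^ (n+2)) * Real.exp (-(c * s ^ 2)) / 2 * fkY1 n c ν (s ^ 2)) * o + 
    (-s ^ (n+2) * Real.exp (-(c * s ^ 2)) / 2 * fkY n c ν (s ^ 2)) * o'

lemma fkW_nonneg (hc : 0 < c) (hν : 0 ≤ ν) {r : ℝ} (hY : ∀ s, 0 ≤ s → s ≤ r → 0 ≤ fkY n c ν (s ^ 2))
    {s : ℝ} (hs : 0 < s) (hsr : s ≤ r) : 0 ≤ fkW n c ν (s ^ 2) := by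
  have hm : MonotoneOn (fun s => s ^ (n + 3) * Real.exp (-(c * s ^ 2)) * fkW n c ν (s ^ 2)) (Icc 0 r) := by
    refine monotoneOn_of_deriv_nonneg (convex_Icc 0 r)
      (fun x _ => (fkW_deriv n ν hc x).continuousAt.continuousWithinAt)
      (fun x _ => (fkW_deriv n ν hc x).differentiableAt.differentiableWithinAt) ?_
    intro x hx
    rw [interior_Icc] at hx
    rw [(fkW_deriv n ν hc x).deriv]
    have h0 := hY x hx.1.le hx.2.le
    have h1 := fkY1_nonpos n ν hc hν hY hx.1.le hx.2.le
    have h2 := Real.exp_pos (-(c * x ^ 2))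
    have h3 : 0 ≤ x ^ (n + 2) := pow_nonneg hx.1.le _
    have h4 : 0 ≤ c * fkY n c ν (x ^ 2) * (-fkY1 n c ν (x ^ 2)) :=
      mul_nonneg (by positivity) (by linarith)
    refine mul_nonneg (by positivity) ?_
    nlinarith [sq_nonneg (fkY1 n c ν (x ^ 2))]
  have := hm (left_mem_Icc.mpr (hs.le.trans hsr)) ⟨hs.le, hsr⟩ hs.le
  simp only [ne_eq, Nat.add_eq_zero_iff, OfNat.ofNat_ne_zero, and_false, not_false_eq_true, zero_pow, zero_mul] at this
  exact nonneg_of_mul_nonneg_right this (by positivity)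

noncomputable def fkgg (n : ℕ) (c ν s : ℝ) : ℝ := s * (c + -2 * fkY1 n c ν (s ^ 2) / fkY n c ν (s ^ 2))

lemma fkκ_deriv (hc : 0 < c) {s : ℝ} (hY : fkY n c ν (s ^ 2) ≠ 0) :
    HasDerivAt (fun s => c + -2 * fkY1 n c ν (s ^ 2) / fkY n c ν (s ^ 2))
      (4 * s * fkW n c ν (s ^ 2) / fkY n c ν (s ^ 2) ^ 2) s := by
  have h0 := (fkY_deriv n ν hc (s ^ 2)).comp s (hasDerivAt_pow 2 s)
  have h1 := (fkY1_deriv n ν hc (s ^ 2)).comp s (hasDerivAt_pow 2 s)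
  have h := ((h1.const_mul (-2)).div h0 hY).const_add c
  refine HasDerivAt.congr_deriv h ?_
  simp only [fkW, Function.comp]
  push_cast
  field_simp
  ring

lemma fkgg_mono (hc : 0 < c) (hν : 0 ≤ ν) {r : ℝ} (hY : ∀ s, 0 ≤ s → s ≤ r → 0 < fkY n c ν (s ^ 2)) :
    MonotoneOn (fkgg n c ν) (Icc 0 r) ∧ ∀ s ∈ Icc 0 r, 0 ≤ fkgg n c ν s := by
  have hY' : ∀ s, 0 ≤ s → s ≤ r → 0 ≤ fkY n c ν (s ^ 2) := fun s h1 h2 => (hY s h1 h2).le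
  have hm : MonotoneOn (fun s => c + -2 * fkY1 n c ν (s ^ 2) / fkY n c ν (s ^ 2)) (Icc 0 r) := by
    refine monotoneOn_of_deriv_nonneg (convex_Icc 0 r)
      (fun x hx => (fkκ_deriv n ν hc (hY x hx.1 hx.2).ne').continuousAt.continuousWithinAt)
      (fun x hx => ?_) ?_
    · rw [interior_Icc] at hx
      exact (fkκ_deriv n ν hc (hY x hx.1.le hx.2.le).ne').differentiableAt.differentiableWithinAt
    · intro x hx
      rw [interior_Icc] at hx
      rw [(fkκ_deriv n ν hc (hY x hx.1.le hx.2.le).ne').deriv]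
      have := fkW_nonneg n ν hc hν hY' hx.1 hx.2.le
      have := hx.1
      positivity
  have h0 : ∀ s ∈ Icc 0 r, 0 ≤ c + -2 * fkY1 n c ν (s ^ 2) / fkY n c ν (s ^ 2) := by
    intro s hs
    have h1 := fkY1_nonpos n ν hc hν hY' hs.1 hs.2
    have h2 := hY s hs.1 hs.2
    have : 0 ≤ -2 * fkY1 n c ν (s ^ 2) / fkY n c ν (s ^ 2) := div_nonneg (by linarith) h2.le
    linarith
  refine ⟨fun a ha b hb hab => ?_, fun s hs => mul_nonneg hs.1 (h0 s hs)⟩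
  exact mul_le_mul hab (hm ha hb hab) (h0 a ha) hb.1

lemma fkgg_cont (hc : 0 < c) {r : ℝ} (hY : ∀ s, 0 ≤ s → s ≤ r → 0 < fkY n c ν (s ^ 2)) :
    ContinuousOn (fkgg n c ν) (Icc 0 r) := fun x hx =>
  (continuousAt_id.mul (fkκ_deriv n ν hc (hY x hx.1 hx.2).ne').continuousAt).continuousWithinAt

lemma fkgg_riccati (hc : 0 < c) {s : ℝ} (hY : fkY n c ν (s ^ 2) ≠ 0) :
    HasDerivAt (fun s => s ^ n * fkgg n c ν s)
      (s ^ n * ((n + 1) * c + ν - c ^ 2 * s ^ 2 + fkgg n c ν s ^ 2)) s := by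
  have h := (hasDerivAt_pow (n + 1) s).mul (fkκ_deriv n ν hc hY)
  have o := fkY_ode n ν hc (s ^ 2)
  refine HasDerivAt.congr_of_eventuallyEq ?_
    (f := fun s => s ^ (n + 1) * (c + -2 * fkY1 n c ν (s ^ 2) / fkY n c ν (s ^ 2)))
    (Eventually.of_forall fun s => by simp only [fkgg]; ring)
  refine HasDerivAt.congr_deriv h ?_
  simp only [fkgg, fkW, Nat.add_sub_cancel]
  push_cast
  field_simp
  linear_combination -s ^ n * fkY n c ν (s ^ 2) * o

lemma fkgg_int (hc : 0 < c) {r : ℝ} (hY : ∀ s, 0 ≤ s → s ≤ r → 0 < fkY n c ν (s ^ 2)) {ρ : ℝ} (h0 : 0 ≤ ρ) (h1 : ρ ≤ r)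
    (hn : 1 ≤ n) :
    ρ ^ n * fkgg n c ν ρ + ∫ s in (0:ℝ)..ρ, s ^ n * (c ^ 2 * s ^ 2) =
      (∫ s in (0:ℝ)..ρ, s ^ n * ((n + 1) * c + ν)) + ∫ s in (0:ℝ)..ρ, s ^ n * fkgg n c ν s ^ 2 := by
  have hcg : ContinuousOn (fkgg n c ν) (uIcc 0 ρ) := by
    rw [uIcc_of_le h0]
    exact (fkgg_cont n ν hc hY).mono (Icc_subset_Icc_right h1)
  have i1 : IntervalIntegrable (fun s => s ^ n * (c ^ 2 * s ^ 2)) volume 0 ρ := by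
    apply Continuous.intervalIntegrable; fun_prop
  have i2 : IntervalIntegrable (fun s => s ^ n * ((n + 1) * c + ν)) volume 0 ρ := by
    apply Continuous.intervalIntegrable; fun_prop
  have i3 : IntervalIntegrable (fun s => s ^ n * fkgg n c ν s ^ 2) volume 0 ρ := by
    apply ContinuousOn.intervalIntegrable; fun_prop
  have key := intervalIntegral.integral_eq_sub_of_hasDerivAt (a := 0) (b := ρ)
    (f := fun s => s ^ n * fkgg n c ν s) (fun x hx => fkgg_riccati n ν hc (s := x) (by
      rw [uIcc_of_le h0] at hx
      exact (hY x hx.1 (hx.2.trans h1)).ne')) (by apply ContinuousOn.intervalIntegrable; fun_prop)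
  have e : ∀ s : ℝ, s ^ n * ((n + 1) * c + ν - c ^ 2 * s ^ 2 + fkgg n c ν s ^ 2) =
    s ^ n * ((n + 1) * c + ν) - s ^ n * (c ^ 2 * s ^ 2) + s ^ n * fkgg n c ν s ^ 2 := fun s => by ring
  simp only [e] at key
  rw [intervalIntegral.integral_add (i2.sub i1) i3, intervalIntegral.integral_sub i2 i1] at key
  have hz : (0:ℝ) ^ n = 0 := zero_pow (by omega)
  rw [hz, zero_mul, sub_zero] at key
  linarith
end hfun

lemma fk_polar (n : ℕ) {k : ℝ → ℝ} {ρ : ℝ} (h0 : 0 ≤ ρ) (hk : ContinuousOn k (Icc 0 ρ))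
    (hk0 : ∀ s ∈ Icc 0 ρ, 0 ≤ k s) :
    ∫⁻ x in Metric.ball (0 : EuclideanSpace ℝ (Fin (n + 1))) ρ, ENNReal.ofReal (k ‖x‖) =
      ENNReal.ofReal ((n + 1) * fkω n * ∫ s in (0:ℝ)..ρ, s ^ n * k s) := by
  have hcont : ContinuousOn (fun x : EuclideanSpace ℝ (Fin (n + 1)) => k ‖x‖) (Metric.closedBall 0 ρ) := by
    refine hk.comp continuous_norm.continuousOn ?_
    intro x hx
    exact ⟨norm_nonneg x, by simpa using hx⟩
  have hint : IntegrableOn (fun x : EuclideanSpace ℝ (Fin (n + 1)) => k ‖x‖) (Metric.ball 0 ρ) :=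
    (hcont.integrableOn_compact (isCompact_closedBall _ _)).mono_set Metric.ball_subset_closedBall
  have hpos : ∀ᵐ x ∂(volume.restrict (Metric.ball (0 : EuclideanSpace ℝ (Fin (n + 1))) ρ)), 0 ≤ k ‖x‖ := by
    refine (ae_restrict_iff' Metric.isOpen_ball.measurableSet).mpr (Eventually.of_forall fun x hx => ?_)
    exact hk0 _ ⟨norm_nonneg x, by rw [mem_ball_zero_iff] at hx; exact hx.le⟩
  rw [← ofReal_integral_eq_lintegral_ofReal hint hpos]
  congr 1
  have e := integral_fun_norm_addHaar (volume : Measure (EuclideanSpace ℝ (Fin (n + 1)))) ((Iio ρ).indicator k)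
  have e1 : (fun x : EuclideanSpace ℝ (Fin (n + 1)) => (Iio ρ).indicator k ‖x‖) =
      (Metric.ball (0 : EuclideanSpace ℝ (Fin (n + 1))) ρ).indicator (fun x => k ‖x‖) := by
    ext x
    simp only [indicator, mem_Iio, mem_ball_zero_iff]
  rw [e1, integral_indicator Metric.isOpen_ball.measurableSet] at e
  rw [e]
  simp only [finrank_euclideanSpace, Fintype.card_fin, Nat.add_sub_cancel, nsmul_eq_mul, smul_eq_mul]
  have e2 : (fun y : ℝ => y ^ n * (Iio ρ).indicator k y) = (Iio ρ).indicator (fun y => y ^ n * k y) := by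
    ext y
    simp only [indicator]; split_ifs <;> simp
  rw [e2, setIntegral_indicator measurableSet_Iio, Ioi_inter_Iio,
    intervalIntegral.integral_of_le h0, integral_Ioc_eq_integral_Ioo]
  have e3 : (volume : Measure (EuclideanSpace ℝ (Fin (n + 1)))).real (Metric.ball 0 1) = fkω n := rfl
  rw [e3]; push_cast; ring

lemma fk_hid (n : ℕ) (hn : 1 ≤ n) {c : ℝ} (hc : 0 < c) {ν : ℝ} (hν : 0 ≤ ν) {r : ℝ} (hr : 0 ≤ r)
    (hY : ∀ s, 0 ≤ s → s ≤ r → 0 < fkY n c ν (s ^ 2)) :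
    ∃ h : ℝ → ℝ, Monotone h ∧ (∀ s, 0 ≤ h s) ∧ (∃ H, ∀ s, h s ≤ H) ∧ ∀ ρ, 0 ≤ ρ → ρ ≤ r →
      ENNReal.ofReal ((n + 1) * fkω n * ρ ^ n * h ρ) +
      ∫⁻ x in Metric.ball (0 : EuclideanSpace ℝ (Fin (n + 1))) ρ, ENNReal.ofReal (c ^ 2 * (max ‖x‖ 0) ^ 2) =
      ENNReal.ofReal ((n + 1) * c + ν) * volume (Metric.ball (0 : EuclideanSpace ℝ (Fin (n + 1))) ρ) +
      ∫⁻ x in Metric.ball (0 : EuclideanSpace ℝ (Fin (n + 1))) ρ, ENNReal.ofReal (h ‖x‖ ^ 2) := by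
  obtain ⟨hm, h0⟩ := fkgg_mono n ν hc hν hY
  have hcl : ∀ s, max 0 (min s r) ∈ Icc 0 r := fun s => ⟨le_max_left _ _, max_le hr (min_le_right _ _)⟩
  have hcl2 : ∀ s, 0 ≤ s → s ≤ r → max 0 (min s r) = s := fun s h1 h2 => by
    rw [min_eq_left h2, max_eq_right h1]
  refine ⟨fun s => fkgg n c ν (max 0 (min s r)), ?_, fun s => h0 _ (hcl s),
    ⟨fkgg n c ν r, fun s => hm (hcl s) (right_mem_Icc.mpr hr) (hcl s).2⟩, ?_⟩
  · intro a b hab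
    exact hm (hcl a) (hcl b) (max_le_max le_rfl (min_le_min hab le_rfl))
  intro ρ hρ0 hρr
  simp only
  have hωp := fkω_pos n
  rw [hcl2 ρ hρ0 hρr]
  have v1 : ∫⁻ x in Metric.ball (0 : EuclideanSpace ℝ (Fin (n + 1))) ρ, ENNReal.ofReal (c ^ 2 * (max ‖x‖ 0) ^ 2) =
      ENNReal.ofReal ((n + 1) * fkω n * ∫ s in (0:ℝ)..ρ, s ^ n * (c ^ 2 * s ^ 2)) := by
    rw [← fk_polar n hρ0 (k := fun s => c ^ 2 * s ^ 2) (by fun_prop) (fun s _ => by positivity)]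
    simp
  have v2 : ENNReal.ofReal ((n + 1) * c + ν) * volume (Metric.ball (0 : EuclideanSpace ℝ (Fin (n + 1))) ρ) =
      ENNReal.ofReal ((n + 1) * fkω n * ∫ s in (0:ℝ)..ρ, s ^ n * ((n + 1) * c + ν)) := by
    rw [← fk_polar n hρ0 (k := fun s => (n + 1) * c + ν) (by fun_prop) (fun s _ => by positivity)]
    simp
  have hsub : Icc 0 ρ ⊆ Icc 0 r := Icc_subset_Icc_right hρr
  have v3 : ∫⁻ x in Metric.ball (0 : EuclideanSpace ℝ (Fin (n + 1))) ρ,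
      ENNReal.ofReal (fkgg n c ν (max 0 (min ‖x‖ r)) ^ 2) =
      ENNReal.ofReal ((n + 1) * fkω n * ∫ s in (0:ℝ)..ρ, s ^ n * fkgg n c ν s ^ 2) := by
    rw [← fk_polar n hρ0 (k := fun s => fkgg n c ν s ^ 2) (((fkgg_cont n ν hc hY).mono hsub).pow 2)
      (fun s _ => sq_nonneg _)]
    refine setLIntegral_congr_fun Metric.isOpen_ball.measurableSet fun x hx => ?_
    rw [mem_ball_zero_iff] at hx
    change ENNReal.ofReal (fkgg n c ν (max 0 (min ‖x‖ r)) ^ 2) = ENNReal.ofReal (fkgg n c ν ‖x‖ ^ 2)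
    rw [hcl2 _ (norm_nonneg x) (hx.le.trans hρr)]
  rw [v1, v2, v3]
  have nn : ∀ k : ℝ → ℝ, (∀ s, 0 ≤ s → 0 ≤ k s) → 0 ≤ (n + 1) * fkω n * ∫ s in (0:ℝ)..ρ, s ^ n * k s := by
    intro k hk
    refine mul_nonneg (by positivity) (intervalIntegral.integral_nonneg hρ0 fun s hs => ?_)
    exact mul_nonneg (pow_nonneg hs.1 n) (hk s hs.1)
  have hg := h0 ρ ⟨hρ0, hρr⟩
  rw [← ENNReal.ofReal_add (by positivity) (nn (fun s => c ^ 2 * s ^ 2) fun s _ => by positivity),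
    ← ENNReal.ofReal_add (nn (fun s => (n + 1) * c + ν) fun s _ => by positivity)
      (nn (fun s => fkgg n c ν s ^ 2) fun s _ => by positivity)]
  congr 1
  have := fkgg_int n ν hc hY hρ0 hρr hn
  linear_combination ((n + 1) * fkω n) * this

section gauge
variable {n : ℕ}

lemma fk_ibp {ψ : EuclideanSpace ℝ (Fin (n + 1)) → ℝ} (hψ : ContDiff ℝ 1 ψ) (hc : HasCompactSupport ψ)
    {Q Q' : ℝ → ℝ} (hQ : ∀ z, HasDerivAt Q (Q' z) z) (hQ' : Continuous Q') :
    ∫ x, fderiv ℝ ψ x x * Q (‖x‖ ^ 2) =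
      - ∫ x, ψ x * ((n + 1) * Q (‖x‖ ^ 2) + 2 * ‖x‖ ^ 2 * Q' (‖x‖ ^ 2)) := by
  have hQc : Continuous Q := continuous_iff_continuousAt.mpr fun z => (hQ z).continuousAt
  have hψc := hψ.continuous
  have hdc : Continuous (fderiv ℝ ψ) := hψ.continuous_fderiv (by norm_num)
  have hcd := hc.fderiv ℝ
  let e : Fin (n + 1) → EuclideanSpace ℝ (Fin (n + 1)) := fun i => EuclideanSpace.single i 1
  let F : Fin (n + 1) → EuclideanSpace ℝ (Fin (n + 1)) → ℝ := fun i x => x i * Q (‖x‖ ^ 2)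
  have hF : ∀ i x, HasFDerivAt (F i) (x i • (Q' (‖x‖ ^ 2) • (2 • innerSL ℝ x)) + Q (‖x‖ ^ 2) •
      (EuclideanSpace.proj i : EuclideanSpace ℝ (Fin (n + 1)) →L[ℝ] ℝ)) x := by
    intro i x
    have h1 : HasFDerivAt (fun x : EuclideanSpace ℝ (Fin (n + 1)) => x i)
      (EuclideanSpace.proj i : EuclideanSpace ℝ (Fin (n + 1)) →L[ℝ] ℝ) x :=
      (EuclideanSpace.proj i : EuclideanSpace ℝ (Fin (n + 1)) →L[ℝ] ℝ).hasFDerivAt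
    have h2 := (hQ (‖x‖ ^ 2)).comp_hasFDerivAt x (hasStrictFDerivAt_norm_sq x).hasFDerivAt
    exact h1.mul h2
  have hFe : ∀ i x, fderiv ℝ (F i) x (e i) = Q (‖x‖ ^ 2) + 2 * (x i) ^ 2 * Q' (‖x‖ ^ 2) := by
    intro i x
    rw [(hF i x).fderiv]
    simp [e, EuclideanSpace.inner_single_right]
    ring
  have hFc : ∀ i, Continuous (F i) := fun i => by simp only [F]; fun_prop
  have hdce : ∀ i, HasCompactSupport fun x => fderiv ℝ ψ x (e i) := fun i =>
    hcd.comp_left (g := fun L : EuclideanSpace ℝ (Fin (n + 1)) →L[ℝ] ℝ => L (e i)) (by simp)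
  have i1 : ∀ i, Integrable fun x => F i x * fderiv ℝ ψ x (e i) := fun i =>
    Continuous.integrable_of_hasCompactSupport ((hFc i).mul (by fun_prop)) (hdce i).mul_left
  have i2 : ∀ i, Integrable fun x => fderiv ℝ (F i) x (e i) * ψ x := fun i => by
    simp only [hFe]
    exact Continuous.integrable_of_hasCompactSupport (by fun_prop) hc.mul_left
  have key : ∀ i, ∫ x, F i x * fderiv ℝ ψ x (e i) = - ∫ x, fderiv ℝ (F i) x (e i) * ψ x := fun i =>
    integral_mul_fderiv_eq_neg_fderiv_mul_of_integrable (i2 i) (i1 i)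
      (Continuous.integrable_of_hasCompactSupport ((hFc i).mul hψc) hc.mul_left)
      (fun x _ => (hF i x).differentiableAt) (fun x _ => (hψ.differentiable (by norm_num)).differentiableAt)
  have s := Finset.sum_congr (rfl : (Finset.univ : Finset (Fin (n + 1))) = Finset.univ) fun i _ => key i
  rw [Finset.sum_neg_distrib, ← integral_finsetSum _ (fun i _ => i1 i), ← integral_finsetSum _ (fun i _ => i2 i)] at s
  have hx : ∀ x : EuclideanSpace ℝ (Fin (n + 1)), x = ∑ i, x i • e i := by
    intro x
    ext j
    simp [e, Pi.single_apply]
  convert s using 1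
  · congr 1
    ext x
    conv_lhs => rw [show fderiv ℝ ψ x x = fderiv ℝ ψ x (∑ i, x i • e i) by rw [← hx x]]
    rw [map_sum, Finset.sum_mul]
    refine Finset.sum_congr rfl fun i _ => ?_
    simp only [F, map_smul, smul_eq_mul]; ring
  · congr 2
    ext x
    simp only [hFe]
    rw [← Finset.sum_mul, Finset.sum_add_distrib, ← Finset.sum_mul, ← Finset.mul_sum, EuclideanSpace.norm_sq_eq]
    simp
    ring

lemma fk_norm_grad (u : EuclideanSpace ℝ (Fin (n + 1)) → ℝ) (x) : ‖gradient u x‖ = ‖fderiv ℝ u x‖ := by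
  simp [gradient]

lemma fk_inner_grad (u : EuclideanSpace ℝ (Fin (n + 1)) → ℝ) (x y) :
    inner ℝ (gradient u x) y = fderiv ℝ u x y := by
  simp [gradient]

/-- gauge -/
lemma fk_gauge {u : EuclideanSpace ℝ (Fin (n + 1)) → ℝ} (hu : ContDiff ℝ (⊤ : ℕ∞) u) (c : ℝ) (x) :
    ‖fderiv ℝ (fun x => u x * Real.exp (c / 2 * ‖x‖ ^ 2)) x‖ ^ 2 + c ^ 2 * ‖x‖ ^ 2 * (u x * Real.exp (c / 2 * ‖x‖ ^ 2)) ^ 2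
      = ‖fderiv ℝ u x‖ ^ 2 * Real.exp (c * ‖x‖ ^ 2) +
        c * (fderiv ℝ (fun x => (u x * Real.exp (c / 2 * ‖x‖ ^ 2)) ^ 2) x x) := by
  have hud : DifferentiableAt ℝ u x := (hu.differentiable (by simp)).differentiableAt
  have h2 := (((hasStrictFDerivAt_norm_sq x).hasFDerivAt).const_mul (c / 2)).exp
  have hv := hud.hasFDerivAt.mul h2
  have hw := hv.pow 2
  have hw' : fderiv ℝ (fun x => (u x * Real.exp (c / 2 * ‖x‖ ^ 2)) ^ 2) x = _ := hw.fderiv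
  have hv' : fderiv ℝ (fun x => u x * Real.exp (c / 2 * ‖x‖ ^ 2)) x = _ := hv.fderiv
  rw [hw', hv']
  have ee : Real.exp (c * ‖x‖ ^ 2) = Real.exp (c / 2 * ‖x‖ ^ 2) ^ 2 := by
    rw [← Real.exp_nat_mul]; congr 1; push_cast; ring
  rw [ee]
  set E := Real.exp (c / 2 * ‖x‖ ^ 2)
  have e1 : (u x • E • (c / 2) • 2 • (innerSL ℝ) x + E • fderiv ℝ u x) =
      innerSL ℝ (E • gradient u x + (c * u x * E) • x) := by
    ext y
    simp [inner_add_left, inner_smul_left, fk_inner_grad]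
    ring
  have e2 : ‖(u x • E • (c / 2) • 2 • (innerSL ℝ) x + E • fderiv ℝ u x)‖ ^ 2 =
      E ^ 2 * ‖fderiv ℝ u x‖ ^ 2 + 2 * (E * (c * u x * E) * fderiv ℝ u x x) + (c * u x * E) ^ 2 * ‖x‖ ^ 2 := by
    rw [e1, innerSL_apply_norm, norm_add_sq_real, norm_smul, norm_smul, inner_smul_left, inner_smul_right,
      fk_inner_grad, fk_norm_grad, mul_pow, mul_pow, Real.norm_eq_abs, Real.norm_eq_abs, sq_abs, sq_abs]
    simp
    ring
  rw [e2]
  simp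
  ring

end gauge

lemma fk_lower_bound {n : ℕ} (hn : 1 ≤ n) {c : ℝ} (hc : 0 < c) {ν : ℝ} (hν : 0 ≤ ν) {r : ℝ} (hr : 0 ≤ r)
    (hY : ∀ s, 0 ≤ s → s ≤ r → 0 < fkY n c ν (s ^ 2))
    {u : EuclideanSpace ℝ (Fin (n + 1)) → ℝ} (hu : ContDiff ℝ (⊤ : ℕ∞) u) (hcs : HasCompactSupport u)
    (hvol : volume {x | u x ≠ 0} ≤ volume (Metric.ball (0 : EuclideanSpace ℝ (Fin (n + 1))) r)) :
    (2 * c * (n + 1) + ν) * ∫ x, u x ^ 2 * Real.exp (c * ‖x‖ ^ 2) ≤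
      ∫ x, ‖fderiv ℝ u x‖ ^ 2 * Real.exp (c * ‖x‖ ^ 2) := by
  obtain ⟨h, hm, h0, ⟨H, hH⟩, hid⟩ := fk_hid n hn hc hν hr hY
  set v : EuclideanSpace ℝ (Fin (n + 1)) → ℝ := fun x => u x * Real.exp (c / 2 * ‖x‖ ^ 2) with hv
  set w : EuclideanSpace ℝ (Fin (n + 1)) → ℝ := fun x => v x ^ 2 with hw
  have hns : ContDiff ℝ (⊤ : ℕ∞) fun x : EuclideanSpace ℝ (Fin (n + 1)) => ‖x‖ ^ 2 := contDiff_norm_sq ℝ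
  have hvC : ContDiff ℝ (⊤ : ℕ∞) v := hu.mul (contDiff_const.mul hns).exp
  have hwC : ContDiff ℝ (⊤ : ℕ∞) w := hvC.pow 2
  have hvs : HasCompactSupport v := hcs.mul_right
  have hws : HasCompactSupport w := by
    have : w = fun x => v x * v x := by ext x; simp only [hw]; ring
    rw [this]; exact hvs.mul_right
  have hwc := hwC.continuous
  have hvc := hvC.continuous
  have hw0 : ∀ x, 0 ≤ w x := fun x => sq_nonneg _
  have hwu : ∀ x, w x = u x ^ 2 * Real.exp (c * ‖x‖ ^ 2) := by
    intro x
    simp only [hw, hv, mul_pow]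
    rw [← Real.exp_nat_mul]; congr 2; push_cast; ring
  have hset : {x | 0 < w x} = {x | u x ≠ 0} := by
    ext x
    simp only [mem_ofPred_eq, hw, hv]
    rw [sq_pos_iff]
    simp [Real.exp_ne_zero]
  have hVm : Monotone fun s : ℝ => c ^ 2 * (max s 0) ^ 2 := by
    intro a b hab
    have : max a 0 ≤ max b 0 := max_le_max hab le_rfl
    have h1 : 0 ≤ max a 0 := le_max_right _ _
    simp only
    gcongr
  have core := fk_core hn (by exact_mod_cast contDiff_infty.mp hwC 2) hws hw0 hm h0 hVm (fun s => by positivity) hr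
    (by rw [hset]; exact hvol) hid
  simp only [max_eq_left (norm_nonneg _)] at core
  have hdv : Continuous (fun x => ‖fderiv ℝ v x‖ ^ 2) := ((hvC.continuous_fderiv (by simp)).norm).pow 2
  have iw : Integrable w := hwc.integrable_of_hasCompactSupport hws
  have hdvs : HasCompactSupport fun x => ‖fderiv ℝ v x‖ ^ 2 :=
    (hvs.fderiv ℝ).comp_left (g := fun L => ‖L‖ ^ 2) (by simp)
  have idv : Integrable fun x => ‖fderiv ℝ v x‖ ^ 2 := hdv.integrable_of_hasCompactSupport hdvs
  have iVw : Integrable fun x => c ^ 2 * ‖x‖ ^ 2 * w x :=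
    Continuous.integrable_of_hasCompactSupport (by fun_prop) hws.mul_left
  have hfd : ∀ x, ‖fderiv ℝ w x‖ = 2 * |v x| * ‖fderiv ℝ v x‖ := by
    intro x
    have hd : HasFDerivAt v (fderiv ℝ v x) x := (hvC.differentiable (by simp)).differentiableAt.hasFDerivAt
    have : HasFDerivAt w _ x := hd.pow 2
    rw [this.fderiv]
    rw [norm_smul]
    simp
  have amgm : (∫⁻ x, ENNReal.ofReal (‖fderiv ℝ w x‖ * h (fkρ w (w x)))) ≤
      (∫⁻ x, ENNReal.ofReal (‖fderiv ℝ v x‖ ^ 2)) + ∫⁻ x, ENNReal.ofReal (h (fkρ w (w x)) ^ 2 * w x) := by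
    rw [← lintegral_add_left hdv.measurable.ennreal_ofReal]
    refine lintegral_mono fun x => ?_
    have := hw0 x
    rw [← ENNReal.ofReal_add (by positivity) (by positivity)]
    apply ENNReal.ofReal_le_ofReal
    rw [hfd]
    have e : w x = |v x| ^ 2 := (sq_abs _).symm
    rw [e]
    nlinarith [sq_nonneg (‖fderiv ℝ v x‖ - h (fkρ w (|v x| ^ 2)) * |v x|)]
  have fin : (∫⁻ x, ENNReal.ofReal (h (fkρ w (w x)) ^ 2 * w x)) ≠ ⊤ := by
    have i : Integrable fun x => H ^ 2 * w x := iw.const_mul _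
    refine (lt_of_le_of_lt (lintegral_mono fun x => ENNReal.ofReal_le_ofReal ?_) i.lintegral_lt_top).ne
    have h1 := h0 (fkρ w (w x))
    have h2 := hH (fkρ w (w x))
    have := hw0 x
    gcongr
  have main : ENNReal.ofReal ((n + 1) * c + ν) * (∫⁻ x, ENNReal.ofReal (w x)) ≤
      (∫⁻ x, ENNReal.ofReal (‖fderiv ℝ v x‖ ^ 2)) + ∫⁻ x, ENNReal.ofReal (c ^ 2 * ‖x‖ ^ 2 * w x) := by
    rw [← ENNReal.add_le_add_iff_right fin]
    refine core.trans ((add_le_add_left amgm _).trans (le_of_eq ?_))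
    rw [add_right_comm]
  have p1 : 0 ≤ᵐ[volume] w := Eventually.of_forall hw0
  have p2 : 0 ≤ᵐ[volume] fun x => ‖fderiv ℝ v x‖ ^ 2 := Eventually.of_forall fun x => sq_nonneg _
  have p3 : 0 ≤ᵐ[volume] fun x => c ^ 2 * ‖x‖ ^ 2 * w x := Eventually.of_forall fun x => by
    have := hw0 x; simp only [Pi.zero_apply]; positivity
  rw [← ofReal_integral_eq_lintegral_ofReal iw p1, ← ofReal_integral_eq_lintegral_ofReal idv p2,
    ← ofReal_integral_eq_lintegral_ofReal iVw p3, ← ENNReal.ofReal_mul (by positivity),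
    ← ENNReal.ofReal_add (integral_nonneg_of_ae p2) (integral_nonneg_of_ae p3),
    ENNReal.ofReal_le_ofReal_iff (add_nonneg (integral_nonneg_of_ae p2) (integral_nonneg_of_ae p3)),
    ← integral_add idv iVw] at main
  have ibp := fk_ibp (hwC.of_le (by exact_mod_cast le_top)) hws (Q := fun _ => 1) (Q' := fun _ => 0)
    (fun z => hasDerivAt_const z 1) continuous_const
  simp only [mul_one, mul_zero, add_zero] at ibp
  rw [integral_mul_const] at ibp
  have hdw : Continuous fun x => fderiv ℝ w x x := by
    have := hwC.continuous_fderiv (by simp); fun_prop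
  have idw : Integrable fun x => fderiv ℝ w x x := by
    refine hdw.integrable_of_hasCompactSupport ?_
    refine (hws.fderiv ℝ).mono fun x hx => ?_
    contrapose! hx
    simp only [Function.mem_support, not_not] at hx ⊢
    rw [hx]; simp
  have hdu : Continuous (fun x => ‖fderiv ℝ u x‖ ^ 2 * Real.exp (c * ‖x‖ ^ 2)) := by
    have := hu.continuous_fderiv (by simp); fun_prop
  have idu : Integrable (fun x => ‖fderiv ℝ u x‖ ^ 2 * Real.exp (c * ‖x‖ ^ 2)) := by
    refine hdu.integrable_of_hasCompactSupport ?_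
    have : HasCompactSupport fun x => ‖fderiv ℝ u x‖ ^ 2 :=
      (hcs.fderiv ℝ).comp_left (g := fun L => ‖L‖ ^ 2) (by simp)
    exact this.mul_right
  have gauge : ∫ x, (‖fderiv ℝ v x‖ ^ 2 + c ^ 2 * ‖x‖ ^ 2 * w x) =
      (∫ x, ‖fderiv ℝ u x‖ ^ 2 * Real.exp (c * ‖x‖ ^ 2)) + c * ∫ x, fderiv ℝ w x x := by
    rw [← integral_const_mul, ← integral_add idu (idw.const_mul c)]
    exact integral_congr_ae (Eventually.of_forall fun x => fk_gauge hu c x)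
  rw [gauge, ibp] at main
  simp only [← hwu]
  linarith

noncomputable def fkη (t : ℝ) : ℝ := t * Real.smoothTransition (t - 1)

lemma fkη_contDiff : ContDiff ℝ (⊤ : ℕ∞) fkη :=
  contDiff_id.mul (Real.smoothTransition.contDiff.comp (contDiff_id.sub contDiff_const))

lemma fkη_zero {t : ℝ} (ht : t ≤ 1) : fkη t = 0 := by
  rw [fkη, Real.smoothTransition.zero_of_nonpos (by linarith), mul_zero]

lemma fkη_id {t : ℝ} (ht : 2 ≤ t) : fkη t = t := by
  rw [fkη, Real.smoothTransition.one_of_one_le (by linarith), mul_one]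

lemma fkη_le {t : ℝ} (ht : 0 ≤ t) : 0 ≤ fkη t ∧ fkη t ≤ t :=
  ⟨mul_nonneg ht (Real.smoothTransition.nonneg _),
    mul_le_of_le_one_right ht (Real.smoothTransition.le_one _)⟩

lemma fkη_deriv_one {t : ℝ} (ht : 2 < t) : deriv fkη t = 1 := by
  have : fkη =ᶠ[nhds t] id := by
    filter_upwards [lt_mem_nhds ht] with s hs
    exact fkη_id hs.le
  rw [this.deriv_eq, deriv_id]

lemma fkη_deriv_zero {t : ℝ} (ht : t < 1) : deriv fkη t = 0 := by
  have : fkη =ᶠ[nhds t] fun _ => 0 := by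
    filter_upwards [gt_mem_nhds ht] with s hs
    exact fkη_zero (le_of_lt hs)
  rw [this.deriv_eq, deriv_const]

lemma fkη_deriv_cont : Continuous (deriv fkη) := fkη_contDiff.continuous_deriv (by simp)

lemma fkη_deriv_bound : ∃ M : ℝ, 1 ≤ M ∧ ∀ t, |deriv fkη t| ≤ M := by
  obtain ⟨M, hM⟩ := isCompact_Icc.exists_bound_of_continuousOn (s := Icc (1:ℝ) 2)
    fkη_deriv_cont.continuousOn
  refine ⟨max M 1, le_max_right _ _, fun t => ?_⟩
  rcases lt_or_ge t 1 with h | h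
  · rw [fkη_deriv_zero h]; simp
  rcases lt_or_ge 2 t with h' | h'
  · rw [fkη_deriv_one h']; simp
  · exact (hM t ⟨h, h'⟩).trans (le_max_left _ _)

section test
variable {n : ℕ}

lemma fk_test {U U' : ℝ → ℝ} (hU : ContDiff ℝ (⊤ : ℕ∞) U) (hU' : ∀ z, HasDerivAt U (U' z) z)
    {a : ℝ} (ha : 0 < a) (hUa : U (a ^ 2) = 0) {δ : ℝ} (hδ : 0 < δ) :
    ∃ ψ : EuclideanSpace ℝ (Fin (n + 1)) → ℝ, ContDiff ℝ (⊤ : ℕ∞) ψ ∧ HasCompactSupport ψ ∧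
      tsupport ψ ⊆ Metric.ball 0 a ∧
      (∀ x ∈ Metric.ball 0 a, ψ x = δ * fkη (U (‖x‖ ^ 2) / δ)) ∧
      (∀ x ∉ Metric.ball 0 a, ψ x = 0) ∧
      (∀ x ∈ Metric.ball 0 a, fderiv ℝ ψ x =
        (deriv fkη (U (‖x‖ ^ 2) / δ) * (2 * U' (‖x‖ ^ 2))) • innerSL ℝ x) ∧
      (∀ x ∉ Metric.ball 0 a, fderiv ℝ ψ x = 0) := by
  set B := Metric.ball (0 : EuclideanSpace ℝ (Fin (n + 1))) a with hB
  set φ : EuclideanSpace ℝ (Fin (n + 1)) → ℝ := fun x => δ * fkη (U (‖x‖ ^ 2) / δ) with hφ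
  set ψ : EuclideanSpace ℝ (Fin (n + 1)) → ℝ := B.indicator φ with hψ
  have hns : ContDiff ℝ (⊤ : ℕ∞) fun x : EuclideanSpace ℝ (Fin (n + 1)) => ‖x‖ ^ 2 := contDiff_norm_sq ℝ
  have hφC : ContDiff ℝ (⊤ : ℕ∞) φ :=
    contDiff_const.mul (fkη_contDiff.comp ((hU.comp hns).div_const δ))
  set K := Metric.closedBall (0 : EuclideanSpace ℝ (Fin (n + 1))) a ∩ {x | δ ≤ U (‖x‖ ^ 2)} with hK
  have hUc := hU.continuous
  have hKc : IsCompact K := (isCompact_closedBall _ _).inter_right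
    (isClosed_le continuous_const (by fun_prop))
  have hKB : K ⊆ B := by
    intro x hx
    have h1 := hx.1
    have h2 : δ ≤ U (‖x‖ ^ 2) := hx.2
    rw [mem_closedBall_zero_iff] at h1
    rw [hB, mem_ball_zero_iff]
    refine lt_of_le_of_ne h1 fun h => ?_
    rw [h, hUa] at h2
    linarith
  have hψ0 : ∀ x ∉ K, ψ x = 0 := by
    intro x hx
    simp only [hψ, indicator]
    split_ifs with hxB
    · have : ¬ δ ≤ U (‖x‖ ^ 2) := fun h => hx ⟨Metric.ball_subset_closedBall hxB, h⟩
      simp only [hφ]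
      rw [fkη_zero, mul_zero]
      rw [div_le_one hδ]; linarith
    · rfl
  have hloc : ∀ x ∈ B, ψ =ᶠ[nhds x] φ := fun x hx => by
    filter_upwards [Metric.isOpen_ball.mem_nhds hx] with y hy
    exact indicator_of_mem hy _
  have hloc0 : ∀ x ∉ B, ψ =ᶠ[nhds x] fun _ => 0 := fun x hx => by
    filter_upwards [hKc.isClosed.isOpen_compl.mem_nhds (fun h => hx (hKB h))] with y hy
    exact hψ0 y hy
  have hts : tsupport ψ ⊆ K := by
    refine closure_minimal ?_ hKc.isClosed
    intro x hx
    by_contra h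
    exact hx (hψ0 x h)
  refine ⟨ψ, ?_, HasCompactSupport.intro hKc hψ0, hts.trans hKB, fun x hx => indicator_of_mem hx _,
    fun x hx => indicator_of_notMem hx _, ?_, ?_⟩
  · rw [contDiff_iff_contDiffAt]
    intro x
    by_cases hx : x ∈ B
    · exact hφC.contDiffAt.congr_of_eventuallyEq (hloc x hx)
    · exact contDiffAt_const.congr_of_eventuallyEq (hloc0 x hx)
  · intro x hx
    rw [(hloc x hx).fderiv_eq]
    have h1 := (hU' (‖x‖ ^ 2)).comp_hasFDerivAt x (hasStrictFDerivAt_norm_sq x).hasFDerivAt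
    have h2 : HasDerivAt fkη (deriv fkη (U (‖x‖ ^ 2) / δ)) (U (‖x‖ ^ 2) / δ) :=
      (fkη_contDiff.differentiable (by simp)).differentiableAt.hasDerivAt
    have h3 := h2.comp_hasFDerivAt x (h1.mul_const δ⁻¹)
    have h4 : HasFDerivAt φ _ x := h3.const_mul δ
    rw [h4.fderiv]
    ext y
    simp
    field_simp
  · intro x hx
    rw [(hloc0 x hx).fderiv_eq]
    simp
end test

lemma fk_upper {n : ℕ} {c : ℝ} (hc : 0 < c) {ν : ℝ} {a : ℝ} (ha : 0 < a)
    (hY : ∀ s, 0 ≤ s → s < a → 0 < fkY n c ν (s ^ 2)) (hYa : fkY n c ν (a ^ 2) = 0) {L : ℝ}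
    (hL : 2 * c * (n + 1) + ν < L) :
    ∃ ψ : EuclideanSpace ℝ (Fin (n + 1)) → ℝ, ContDiff ℝ (⊤ : ℕ∞) ψ ∧ HasCompactSupport ψ ∧
      tsupport ψ ⊆ Metric.ball 0 a ∧ 0 < ∫ x, ψ x ^ 2 * Real.exp (c * ‖x‖ ^ 2) ∧
      ∫ x, ‖fderiv ℝ ψ x‖ ^ 2 * Real.exp (c * ‖x‖ ^ 2) < L * ∫ x, ψ x ^ 2 * Real.exp (c * ‖x‖ ^ 2) := by
  set B := Metric.ball (0 : EuclideanSpace ℝ (Fin (n + 1))) a with hB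
  have hBm : MeasurableSet B := Metric.isOpen_ball.measurableSet
  set Y := fkY n c ν with hYdef
  set Y1 := fkY1 n c ν with hY1def
  set Y2 := fkY2 n c ν with hY2def
  have dY : ∀ z, HasDerivAt Y (Y1 z) z := fkY_deriv n ν hc
  have dY1 : ∀ z, HasDerivAt Y1 (Y2 z) z := fkY1_deriv n ν hc
  have cY : Continuous Y := (fkY_contDiff n ν hc).continuous
  have cY1 : Continuous Y1 := (fkY1_contDiff n ν hc).continuous
  have cY2 : Continuous Y2 := (fkY2_contDiff n ν hc).continuous
  set U : ℝ → ℝ := fun z => Real.exp (-(c * z)) * Y z with hU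
  set U' : ℝ → ℝ := fun z => Real.exp (-(c * z)) * (Y1 z - c * Y z) with hU'
  have dU : ∀ z, HasDerivAt U (U' z) z := by
    intro z
    have h1 := (((hasDerivAt_id z).const_mul c).neg.exp).mul (dY z)
    refine HasDerivAt.congr_deriv h1 ?_
    simp only [hU', id, Pi.neg_apply]
    ring
  have cU : ContDiff ℝ (⊤ : ℕ∞) U :=
    ((contDiff_const.mul contDiff_id).neg.exp).mul (fkY_contDiff n ν hc)
  have ccU : Continuous U := cU.continuous
  have ccU' : Continuous U' := by simp only [hU']; fun_prop
  have hUa : U (a ^ 2) = 0 := by simp only [hU, hYa, mul_zero]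
  have hUpos : ∀ x ∈ B, 0 < U (‖x‖ ^ 2) := by
    intro x hx
    rw [hB, mem_ball_zero_iff] at hx
    exact mul_pos (Real.exp_pos _) (hY _ (norm_nonneg x) hx)
  let δ : ℕ → ℝ := fun k => 1 / ((k:ℝ) + 1)
  have hδ : ∀ k, 0 < δ k := fun k => by simp only [δ]; positivity
  have hδ0 : Tendsto δ atTop (nhds 0) := tendsto_one_div_add_atTop_nhds_zero_nat
  choose ψ hψC hψs hψt hψB hψ0 hψd hψd0 using fun k => fk_test (n := n) cU dU ha hUa (hδ k)
  obtain ⟨M, hM1, hM⟩ := fkη_deriv_bound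
  -- eventual values
  have ev : ∀ x ∈ B, ∀ᶠ k in atTop, 2 < U (‖x‖ ^ 2) / δ k := by
    intro x hx
    have h1 := hUpos x hx
    have h2 : ∀ᶠ k in atTop, δ k < U (‖x‖ ^ 2) / 2 := hδ0.eventually_lt_const (by positivity)
    filter_upwards [h2] with k hk
    rw [lt_div_iff₀ (hδ k)]; linarith
  -- general DCT on ball
  have dct : ∀ (F : ℕ → EuclideanSpace ℝ (Fin (n + 1)) → ℝ) (G b : EuclideanSpace ℝ (Fin (n + 1)) → ℝ),
      (∀ k, Continuous (F k)) → Continuous b → (∀ k, ∀ x ∈ B, |F k x| ≤ b x) →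
      (∀ x ∈ B, ∀ᶠ k in atTop, F k x = G x) →
      Tendsto (fun k => ∫ x in B, F k x) atTop (nhds (∫ x in B, G x)) := by
    intro F G b hF hb hbd hlim
    refine tendsto_integral_of_dominated_convergence b (fun k => (hF k).aestronglyMeasurable) ?_ ?_ ?_
    · exact (hb.continuousOn.integrableOn_compact (isCompact_closedBall (0 : EuclideanSpace ℝ (Fin (n + 1))) a)).mono_set
        Metric.ball_subset_closedBall
    · exact fun k => (ae_restrict_iff' hBm).mpr (Eventually.of_forall fun x hx => hbd k x hx)
    · refine (ae_restrict_iff' hBm).mpr (Eventually.of_forall fun x hx => ?_)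
      exact tendsto_const_nhds.congr' ((hlim x hx).mono fun k hk => hk.symm)
  have cη := fkη_contDiff.continuous
  have cη' := fkη_deriv_cont
  set A : EuclideanSpace ℝ (Fin (n + 1)) → ℝ := fun x => 4 * ‖x‖ ^ 2 * U' (‖x‖ ^ 2) ^ 2 * Real.exp (c * ‖x‖ ^ 2) with hA
  have hA0 : ∀ x, 0 ≤ A x := fun x => by simp only [hA]; positivity
  have cA : Continuous A := by simp only [hA]; fun_prop
  set D : EuclideanSpace ℝ (Fin (n + 1)) → ℝ := fun x => U (‖x‖ ^ 2) ^ 2 * Real.exp (c * ‖x‖ ^ 2) with hD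
  have cD : Continuous D := by simp only [hD]; fun_prop
  have hηb : ∀ k, ∀ x ∈ B, |δ k * fkη (U (‖x‖ ^ 2) / δ k)| ≤ U (‖x‖ ^ 2) := by
    intro k x hx
    have h1 := hUpos x hx
    have h3 := fkη_le (div_pos h1 (hδ k)).le
    rw [abs_of_nonneg (mul_nonneg (hδ k).le h3.1)]
    calc _ ≤ δ k * (U (‖x‖ ^ 2) / δ k) := mul_le_mul_of_nonneg_left h3.2 (hδ k).le
      _ = _ := mul_div_cancel₀ _ (hδ k).ne'
  have hηe : ∀ x ∈ B, ∀ᶠ k in atTop, δ k * fkη (U (‖x‖ ^ 2) / δ k) = U (‖x‖ ^ 2) := by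
    intro x hx
    filter_upwards [ev x hx] with k hk
    rw [fkη_id hk.le]; exact mul_div_cancel₀ _ (hδ k).ne'
  -- limits
  have tNum : Tendsto (fun k => ∫ x in B, deriv fkη (U (‖x‖ ^ 2) / δ k) ^ 2 * A x) atTop (nhds (∫ x in B, A x)) := by
    refine dct _ _ (fun x => M ^ 2 * A x) (fun k => by fun_prop) (by fun_prop) ?_ ?_
    · intro k x hx
      rw [abs_mul, abs_pow, abs_of_nonneg (hA0 x)]
      have := hA0 x
      gcongr
      exact hM _
    · intro x hx
      filter_upwards [ev x hx] with k hk
      rw [fkη_deriv_one hk]; ring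
  have tCr1 : Tendsto (fun k => ∫ x in B, deriv fkη (U (‖x‖ ^ 2) / δ k) * A x) atTop (nhds (∫ x in B, A x)) := by
    refine dct _ _ (fun x => M * A x) (fun k => by fun_prop) (by fun_prop) ?_ ?_
    · intro k x hx
      rw [abs_mul, abs_of_nonneg (hA0 x)]
      have := hA0 x
      gcongr
      exact hM _
    · intro x hx
      filter_upwards [ev x hx] with k hk
      rw [fkη_deriv_one hk]; ring
  have tCr2 : Tendsto (fun k => ∫ x in B, (δ k * fkη (U (‖x‖ ^ 2) / δ k)) * Y (‖x‖ ^ 2)) atTop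
      (nhds (∫ x in B, D x)) := by
    refine dct _ _ (fun x => |U (‖x‖ ^ 2)| * |Y (‖x‖ ^ 2)|) (fun k => by fun_prop) (by fun_prop) ?_ ?_
    · intro k x hx
      rw [abs_mul]
      exact mul_le_mul_of_nonneg_right ((hηb k x hx).trans (le_abs_self _)) (abs_nonneg _)
    · intro x hx
      filter_upwards [hηe x hx] with k hk
      rw [hk]
      simp only [hD, hU]
      rw [mul_pow, ← Real.exp_nat_mul]
      have : Real.exp (-(c * ‖x‖ ^ 2)) = Real.exp (↑2 * -(c * ‖x‖ ^ 2)) * Real.exp (c * ‖x‖ ^ 2) := by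
        rw [← Real.exp_add]; congr 1; push_cast; ring
      push_cast at this ⊢
      linear_combination (Y (‖x‖ ^ 2)) ^ 2 * this
  have tDen : Tendsto (fun k => ∫ x in B, (δ k * fkη (U (‖x‖ ^ 2) / δ k)) ^ 2 * Real.exp (c * ‖x‖ ^ 2)) atTop
      (nhds (∫ x in B, D x)) := by
    refine dct _ _ D (fun k => by fun_prop) cD ?_ ?_
    · intro k x hx
      rw [abs_mul, abs_pow, Real.abs_exp]
      simp only [hD]
      gcongr
      exact hηb k x hx
    · intro x hx
      filter_upwards [hηe x hx] with k hk
      rw [hk]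
  have hDpos : 0 < ∫ x in B, D x := by
    have hint : IntegrableOn D B :=
      (cD.continuousOn.integrableOn_compact (isCompact_closedBall (0 : EuclideanSpace ℝ (Fin (n + 1))) a)).mono_set
        Metric.ball_subset_closedBall
    rw [setIntegral_pos_iff_support_of_nonneg_ae (Eventually.of_forall fun x => by
      simp only [hD, Pi.zero_apply]; positivity) hint]
    have : Function.support D ∩ B = B := by
      apply inter_eq_right.mpr
      intro x hx
      have := hUpos x hx
      simp only [Function.mem_support, hD]; positivity
    rw [this]
    exact Metric.measure_ball_pos _ _ ha
  -- identities
  have toB : ∀ F G : EuclideanSpace ℝ (Fin (n + 1)) → ℝ, (∀ x ∈ B, F x = G x) → (∀ x ∉ B, F x = 0) →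
      ∫ x, F x = ∫ x in B, G x := by
    intro F G h1 h2
    rw [← setIntegral_congr_fun hBm h1, setIntegral_eq_integral_of_forall_compl_eq_zero h2]
  have iNum : ∀ k, ∫ x, ‖fderiv ℝ (ψ k) x‖ ^ 2 * Real.exp (c * ‖x‖ ^ 2) =
      ∫ x in B, deriv fkη (U (‖x‖ ^ 2) / δ k) ^ 2 * A x := by
    intro k
    refine toB _ _ (fun x hx => ?_) (fun x hx => by rw [hψd0 k x hx]; simp)
    rw [hψd k x hx, norm_smul, innerSL_apply_norm, mul_pow, Real.norm_eq_abs, sq_abs]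
    simp only [hA]; ring
  have iDen : ∀ k, ∫ x, ψ k x ^ 2 * Real.exp (c * ‖x‖ ^ 2) =
      ∫ x in B, (δ k * fkη (U (‖x‖ ^ 2) / δ k)) ^ 2 * Real.exp (c * ‖x‖ ^ 2) := by
    intro k
    refine toB _ _ (fun x hx => ?_) (fun x hx => by rw [hψ0 k x hx]; simp)
    rw [hψB k x hx]
  have iCr : ∀ k, ∫ x in B, deriv fkη (U (‖x‖ ^ 2) / δ k) * A x =
      (2 * c * (n + 1) + ν) * ∫ x in B, (δ k * fkη (U (‖x‖ ^ 2) / δ k)) * Y (‖x‖ ^ 2) := by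
    intro k
    have ibp := fk_ibp ((hψC k).of_le (by exact_mod_cast le_top)) (hψs k)
      (Q := fun z => 2 * (Y1 z - c * Y z)) (Q' := fun z => 2 * (Y2 z - c * Y1 z))
      (fun z => ((dY1 z).sub ((dY z).const_mul c)).const_mul 2) (by fun_prop)
    rw [toB (fun x => fderiv ℝ (ψ k) x x * (2 * (Y1 (‖x‖ ^ 2) - c * Y (‖x‖ ^ 2))))
      (fun x => deriv fkη (U (‖x‖ ^ 2) / δ k) * A x) ?_ ?_] at ibp
    · rw [ibp, ← integral_neg, ← integral_const_mul]
      refine toB _ _ (fun x hx => ?_) (fun x hx => by rw [hψ0 k x hx]; simp)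
      rw [hψB k x hx]
      have o := fkY_ode n ν hc (‖x‖ ^ 2)
      simp only [← hYdef, ← hY1def, ← hY2def] at o
      linear_combination (-(δ k * fkη (U (‖x‖ ^ 2) / δ k))) * o
    · intro x hx
      rw [hψd k x hx]
      simp only [hA, hU', smul_apply, innerSL_apply_apply, real_inner_self_eq_norm_sq, smul_eq_mul]
      have : Real.exp (-(c * ‖x‖ ^ 2)) * Real.exp (c * ‖x‖ ^ 2) = 1 := by
        rw [← Real.exp_add]; simp
      linear_combination (-(deriv fkη (U (‖x‖ ^ 2) / δ k)) * 4 * ‖x‖ ^ 2 * Real.exp (-(c * ‖x‖ ^ 2)) *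
        (Y1 (‖x‖ ^ 2) - c * Y (‖x‖ ^ 2)) ^ 2) * this
    · intro x hx
      rw [hψd0 k x hx]; simp
  have lim : ∫ x in B, A x = (2 * c * (n + 1) + ν) * ∫ x in B, D x :=
    tendsto_nhds_unique (tCr1.congr iCr) (tCr2.const_mul _)
  have t1 := tDen.eventually_const_lt hDpos
  have t2 := (tNum.sub (tDen.const_mul L)).eventually_lt_const (u := 0) (by rw [lim]; nlinarith)
  obtain ⟨k, hk1, hk2⟩ := (t1.and t2).exists
  refine ⟨ψ k, hψC k, hψs k, hψt k, ?_, ?_⟩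
  · rw [iDen]; exact hk1
  · rw [iNum, iDen]; linarith

section final
variable {n : ℕ} {c : ℝ}

lemma fkY_zero_nu (n : ℕ) (c z : ℝ) : fkY n c 0 z = 1 := by
  have h : ∀ k, fkb n c 0 (k + 1) = 0 := by
    intro k
    induction k with
    | zero => simp [fkb]
    | succ k ih => rw [fkb, ih, mul_zero]
  rw [fkY, fkF, tsum_eq_single 0]
  · simp [fkb]
  · intro k hk
    obtain ⟨j, rfl⟩ := Nat.exists_eq_succ_of_ne_zero hk
    rw [h, zero_mul]

lemma fk_first_zero (hc : 0 < c) {ν s : ℝ} (hs : 0 ≤ s) (hY : fkY n c ν (s ^ 2) ≤ 0) :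
    ∃ a, 0 < a ∧ a ≤ s ∧ (∀ t, 0 ≤ t → t < a → 0 < fkY n c ν (t ^ 2)) ∧ fkY n c ν (a ^ 2) = 0 := by
  have cY : Continuous fun t : ℝ => fkY n c ν (t ^ 2) :=
    (fkY_contDiff n ν hc).continuous.comp (continuous_pow 2)
  have hK : IsCompact (Icc 0 s ∩ {t | fkY n c ν (t ^ 2) ≤ 0}) :=
    isCompact_Icc.inter_right (isClosed_le cY continuous_const)
  obtain ⟨a, ha, hmin⟩ := hK.exists_isLeast ⟨s, ⟨hs, le_rfl⟩, hY⟩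
  have hpos : ∀ t, 0 ≤ t → t < a → 0 < fkY n c ν (t ^ 2) := by
    intro t h0 hta
    by_contra h
    exact absurd (hmin ⟨⟨h0, hta.le.trans ha.1.2⟩, not_lt.mp h⟩) (not_le.mpr hta)
  have ha2 : fkY n c ν (a ^ 2) ≤ 0 := ha.2
  have ha0 : 0 < a := by
    refine lt_of_le_of_ne ha.1.1 fun h => ?_
    rw [← h] at ha2
    norm_num [fkY_zero] at ha2
  refine ⟨a, ha0, ha.1.2, hpos, le_antisymm ha2 ?_⟩
  refine ge_of_tendsto (x := nhdsWithin a (Iio a)) (cY.continuousAt.tendsto.mono_left nhdsWithin_le_nhds) ?_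
  filter_upwards [Ioo_mem_nhdsLT ha0] with t ht
  exact (hpos t ht.1.le ht.2).le

lemma fk_setint {u : EuclideanSpace ℝ (Fin (n + 1)) → ℝ} {Ω : Set (EuclideanSpace ℝ (Fin (n + 1)))}
    (ht : tsupport u ⊆ Ω) (f : EuclideanSpace ℝ (Fin (n + 1)) → ℝ) :
    (∫ x in Ω, ‖gradient u x‖ ^ 2 * f x) = (∫ x, ‖fderiv ℝ u x‖ ^ 2 * f x) ∧
    (∫ x in Ω, (u x) ^ 2 * f x) = ∫ x, (u x) ^ 2 * f x := by
  constructor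
  · simp only [fk_norm_grad]
    refine setIntegral_eq_integral_of_forall_compl_eq_zero fun x hx => ?_
    have : fderiv ℝ u x = 0 := by
      by_contra h
      exact hx (ht (support_fderiv_subset ℝ h))
    rw [this]; simp
  · refine setIntegral_eq_integral_of_forall_compl_eq_zero fun x hx => ?_
    rw [image_eq_zero_of_notMem_tsupport fun h => hx (ht h)]; simp

lemma fk_den_pos {u : EuclideanSpace ℝ (Fin (n + 1)) → ℝ} (hu : Continuous u) (hcs : HasCompactSupport u)
    (h0 : u ≠ 0) : 0 < ∫ x, u x ^ 2 * Real.exp (c * ‖x‖ ^ 2) := by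
  obtain ⟨x, hx⟩ := Function.ne_iff.mp h0
  refine Continuous.integral_pos_of_hasCompactSupport_nonneg_nonzero (x := x) (by fun_prop) ?_ ?_ ?_
  · have : HasCompactSupport fun x => u x ^ 2 := hcs.comp_left (g := fun t => t ^ 2) (by simp)
    exact this.mul_right
  · intro x
    simp only [Pi.zero_apply]; positivity
  · have := Real.exp_ne_zero (c * ‖x‖ ^ 2)
    simp only [Pi.zero_apply] at hx
    positivity

lemma fk_lam_ge (hn : 1 ≤ n) (hc : 0 < c) {ν : ℝ} (hν : 0 ≤ ν) {r : ℝ} (hr : 0 ≤ r)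
    (hY : ∀ s, 0 ≤ s → s ≤ r → 0 < fkY n c ν (s ^ 2))
    {Ω : Set (EuclideanSpace ℝ (Fin (n + 1)))} (hΩ : IsOpen Ω) (hne : Ω.Nonempty)
    (hvol : volume Ω ≤ volume (Metric.ball (0 : EuclideanSpace ℝ (Fin (n + 1))) r)) :
    2 * c * (n + 1) + ν ≤ lambdaOne (fun x => Real.exp (c * ‖x‖ ^ 2)) Ω := by
  refine le_csInf ?_ ?_
  · obtain ⟨p, hp⟩ := hne
    obtain ⟨u, h1, h2, h3, -, h5⟩ := exists_contDiff_tsupport_subset (n := (⊤ : ℕ∞)) (hΩ.mem_nhds hp)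
    refine ⟨_, u, h3, h2, h1, fun h => ?_, rfl⟩
    rw [h] at h5; simp at h5
  · rintro q ⟨u, hu, hcs, ht, h0, rfl⟩
    obtain ⟨e1, e2⟩ := fk_setint ht fun x => Real.exp (c * ‖x‖ ^ 2)
    rw [e1, e2, le_div_iff₀ (fk_den_pos hu.continuous hcs h0)]
    refine fk_lower_bound hn hc hν hr hY hu hcs (le_trans (measure_mono ?_) hvol)
    intro x hx
    exact ht (subset_tsupport u hx)

lemma fk_lam_lt (hc : 0 < c) {ν : ℝ} {a : ℝ} (ha : 0 < a)
    (hY : ∀ s, 0 ≤ s → s < a → 0 < fkY n c ν (s ^ 2)) (hYa : fkY n c ν (a ^ 2) = 0) {R : ℝ} (hR : a ≤ R) :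
    lambdaOne (fun x => Real.exp (c * ‖x‖ ^ 2)) (Metric.ball (0 : EuclideanSpace ℝ (Fin (n + 1))) R)
      ≤ 2 * c * (n + 1) + ν := by
  refine le_of_forall_gt fun L hL => ?_
  obtain ⟨ψ, h1, h2, h3, h4, h5⟩ := fk_upper hc ha hY hYa hL
  have ht := h3.trans (Metric.ball_subset_ball hR)
  obtain ⟨e1, e2⟩ := fk_setint ht fun x => Real.exp (c * ‖x‖ ^ 2)
  refine lt_of_le_of_lt (csInf_le ⟨0, ?_⟩ ⟨ψ, h1, h2, ht, ?_, rfl⟩) ?_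
  · rintro q ⟨u, -, -, -, -, rfl⟩
    refine div_nonneg ?_ ?_ <;>
    · refine integral_nonneg fun x => ?_
      simp only [Pi.zero_apply]; positivity
  · rintro rfl; simp at h4
  · rw [e1, e2, div_lt_iff₀ h4]; exact h5

lemma fk_ball_pos (hn : 1 ≤ n) (hc : 0 < c) {R : ℝ} (hR : 0 < R) :
    ∃ ν, 0 ≤ ν ∧ lambdaOne (fun x => Real.exp (c * ‖x‖ ^ 2)) (Metric.ball (0 : EuclideanSpace ℝ (Fin (n + 1))) R)
      = 2 * c * (n + 1) + ν ∧ ∀ s, 0 ≤ s → s < R → 0 < fkY n c ν (s ^ 2) := by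
  set Λ := lambdaOne (fun x => Real.exp (c * ‖x‖ ^ 2)) (Metric.ball (0 : EuclideanSpace ℝ (Fin (n + 1))) R) with hΛ
  have h0 : 2 * c * (n + 1) + 0 ≤ Λ :=
    fk_lam_ge hn hc le_rfl hR.le (fun s _ _ => by rw [fkY_zero_nu]; norm_num) Metric.isOpen_ball
      ⟨0, Metric.mem_ball_self hR⟩ le_rfl
  refine ⟨Λ - 2 * c * (n + 1), by linarith, by ring, ?_⟩
  set ν := Λ - 2 * c * (n + 1) with hν
  by_contra! hcon
  obtain ⟨s, hs0, hsR, hsY⟩ := hcon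
  obtain ⟨a, ha0, has, hpos, hz⟩ := fk_first_zero hc hs0 hsY
  have hνpos : 0 < ν := by
    refine lt_of_le_of_ne (by linarith) fun h => ?_
    rw [← h, fkY_zero_nu] at hsY
    norm_num at hsY
  have hneg := fkY1_neg n ν hc hνpos ha0 hpos
  have haR : a < R := has.trans_lt hsR
  have hd : HasDerivAt (fun t => fkY n c ν (t ^ 2)) (fkY1 n c ν (a ^ 2) * ((2:ℕ) * a ^ (2 - 1))) a :=
    (fkY_deriv n ν hc (a ^ 2)).comp a (hasDerivAt_pow 2 a)
  obtain ⟨b, hab, hbR, hb⟩ : ∃ b, a < b ∧ b < R ∧ fkY n c ν (b ^ 2) < 0 := by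
    by_contra! hcon
    have hmin : IsLocalMin (fun t => fkY n c ν (t ^ 2)) a := by
      filter_upwards [Ioo_mem_nhds ha0 haR] with t ht
      rw [hz]
      rcases lt_trichotomy t a with h | h | h
      · exact (hpos t ht.1.le h).le
      · rw [h, hz]
      · exact hcon t h ht.2
    have := hmin.hasDerivAt_eq_zero hd
    norm_num at this
    rcases this with h | h <;> linarith
  have hcν : Continuous fun ν => fkY n c ν (b ^ 2) :=
    (fkY_joint n hc).comp (continuous_id.prodMk continuous_const)
  have hev : ∀ᶠ ν' in nhdsWithin ν (Iio ν), fkY n c ν' (b ^ 2) < 0 :=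
    (hcν.continuousAt.eventually_lt_const hb).filter_mono nhdsWithin_le_nhds
  obtain ⟨ν', h1, h2⟩ := (hev.and self_mem_nhdsWithin).exists
  obtain ⟨a', ha0', has', hpos', hz'⟩ := fk_first_zero hc (ha0.trans hab).le h1.le
  have := fk_lam_lt hc ha0' hpos' hz' (has'.trans hbR.le)
  rw [← hΛ] at this
  have h2' : ν' < ν := h2
  linarith

lemma fk_strict (hn : 1 ≤ n) (hc : 0 < c) {R : ℝ} (hR : 0 < R) {Ω : Set (EuclideanSpace ℝ (Fin (n + 1)))}
    (hΩ : IsOpen Ω) (hne : Ω.Nonempty)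
    (hvol : volume Ω < volume (Metric.ball (0 : EuclideanSpace ℝ (Fin (n + 1))) R)) :
    lambdaOne (fun x => Real.exp (c * ‖x‖ ^ 2)) (Metric.ball (0 : EuclideanSpace ℝ (Fin (n + 1))) R) <
      lambdaOne (fun x => Real.exp (c * ‖x‖ ^ 2)) Ω := by
  obtain ⟨ν, hν, hΛ, hpos⟩ := fk_ball_pos hn hc hR
  have hfin : volume Ω ≠ ⊤ := (hvol.trans_le le_top).ne
  set r := fkrad n (volume Ω) with hr
  have hr0 : 0 ≤ r := fkrad_nonneg _ _
  have hrv : volume (Metric.ball (0 : EuclideanSpace ℝ (Fin (n + 1))) r) = volume Ω := fkrad_vol n hfin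
  have hrR : r < R := by
    by_contra h
    have := measure_mono (μ := volume) (Metric.ball_subset_ball (x := (0 : EuclideanSpace ℝ (Fin (n + 1)))) (not_lt.mp h))
    rw [hrv] at this
    exact absurd hvol (not_lt.mpr this)
  have hO : IsOpen {p : ℝ × ℝ | 0 < fkY n c p.1 (p.2 ^ 2)} :=
    isOpen_lt continuous_const ((fkY_joint n hc).comp (continuous_fst.prodMk (continuous_snd.pow 2)))
  obtain ⟨A, B, hA, -, hνA, hB, hAB⟩ := generalized_tube_lemma (isCompact_singleton (x := ν))
    (isCompact_Icc (a := (0:ℝ)) (b := r)) hO (by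
      rintro ⟨x, s⟩ ⟨hx, hs⟩
      have hx' : x = ν := hx
      subst hx'
      exact hpos s hs.1 (hs.2.trans_lt hrR))
  have hev : ∀ᶠ ν' in nhdsWithin ν (Ioi ν), ν' ∈ A :=
    Filter.Eventually.filter_mono nhdsWithin_le_nhds (hA.mem_nhds (hνA rfl))
  obtain ⟨ν', h1, h2⟩ := (hev.and self_mem_nhdsWithin).exists
  have h2' : ν < ν' := h2
  have := fk_lam_ge hn hc (hν.trans h2'.le) hr0 (fun s hs0 hsr => hAB (mk_mem_prod h1 (hB ⟨hs0, hsr⟩))) hΩ hne hrv.ge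
  rw [hΛ]
  linarith

lemma fk_eq_ball (hc : 0 < c) {R : ℝ} (hR : 0 < R) {Ω : Set (EuclideanSpace ℝ (Fin (n + 1)))}
    (hΩ : IsOpen Ω) (hsm : HasSmoothBoundary Ω)
    (hw : wvol (fun x => Real.exp (c * ‖x‖ ^ 2)) (Metric.ball (0 : EuclideanSpace ℝ (Fin (n + 1))) R) =
      wvol (fun x => Real.exp (c * ‖x‖ ^ 2)) Ω)
    (hvol : volume (Metric.ball (0 : EuclideanSpace ℝ (Fin (n + 1))) R) ≤ volume Ω) :
    Ω = Metric.ball (0 : EuclideanSpace ℝ (Fin (n + 1))) R := by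
  set B := Metric.ball (0 : EuclideanSpace ℝ (Fin (n + 1))) R with hB
  have hBo : IsOpen B := Metric.isOpen_ball
  have hBm : MeasurableSet B := hBo.measurableSet
  have hΩm := hΩ.measurableSet
  set g : EuclideanSpace ℝ (Fin (n + 1)) → ENNReal := fun x => ENNReal.ofReal (Real.exp (c * ‖x‖ ^ 2)) with hg
  have hgm : Measurable g := by
    apply Measurable.ennreal_ofReal; fun_prop
  set F : ENNReal := ENNReal.ofReal (Real.exp (c * R ^ 2)) with hF
  have hF0 : F ≠ 0 := by simp [hF, Real.exp_pos]
  have hFt : F ≠ ⊤ := ENNReal.ofReal_ne_top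
  have hBf : volume B ≠ ⊤ := measure_ball_lt_top.ne
  have g1 : ∀ x ∈ B, g x < F := by
    intro x hx
    rw [hB, mem_ball_zero_iff] at hx
    refine (ENNReal.ofReal_lt_ofReal_iff (Real.exp_pos _)).mpr (Real.exp_lt_exp.mpr ?_)
    have := pow_lt_pow_left₀ hx (norm_nonneg x) (n := 2) (by norm_num)
    nlinarith
  have g2 : ∀ x ∉ B, F ≤ g x := by
    intro x hx
    rw [hB, mem_ball_zero_iff, not_lt] at hx
    refine ENNReal.ofReal_le_ofReal (Real.exp_le_exp.mpr ?_)
    gcongr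
  have hw' : ∫⁻ x in B, g x = ∫⁻ x in Ω, g x := hw
  have hIB : ∫⁻ x in B, g x ≠ ⊤ := by
    refine (lt_of_le_of_lt (setLIntegral_mono' hBm fun x hx => (g1 x hx).le) ?_).ne
    rw [setLIntegral_const]
    exact ENNReal.mul_lt_top hFt.lt_top hBf.lt_top
  have hI : ∫⁻ x in B \ Ω, g x = ∫⁻ x in Ω \ B, g x := by
    have h1 := lintegral_inter_add_sdiff (μ := volume) g B hΩm
    have h2 := lintegral_inter_add_sdiff (μ := volume) g Ω hBm
    rw [inter_comm Ω B, ← hw', ← h1] at h2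
    refine ((ENNReal.add_right_inj ?_).mp h2).symm
    exact ((lintegral_mono_set inter_subset_left).trans_lt hIB.lt_top).ne
  have hV : volume (B \ Ω) ≤ volume (Ω \ B) := by
    have h1 := measure_inter_add_sdiff (μ := volume) B hΩm
    have h2 := measure_inter_add_sdiff (μ := volume) Ω hBm
    rw [inter_comm Ω B] at h2
    rw [← h1, ← h2] at hvol
    exact (ENNReal.add_le_add_iff_left ((measure_mono inter_subset_left).trans_lt hBf.lt_top).ne).mp hvol
  have hJ : F * volume (Ω \ B) ≤ ∫⁻ x in Ω \ B, g x := by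
    rw [← setLIntegral_const]
    exact setLIntegral_mono' (hΩm.diff hBm) fun x hx => g2 x hx.2
  have z1 : volume (B \ Ω) = 0 := by
    by_contra hne
    have h1 : ∫⁻ x in B \ Ω, g x < ∫⁻ x in B \ Ω, F :=
      setLIntegral_strict_mono (hBm.diff hΩm) hne measurable_const
        ((lintegral_mono_set sdiff_subset).trans_lt hIB.lt_top).ne
        (Eventually.of_forall fun x hx => g1 x hx.1)
    rw [setLIntegral_const, hI] at h1
    exact absurd (h1.trans_le (mul_le_mul_right hV F)) (not_lt.mpr hJ)
  have z2 : volume (Ω \ B) = 0 := by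
    rw [setLIntegral_measure_zero _ _ z1] at hI
    rw [← hI] at hJ
    have := le_zero_iff.mp hJ
    exact (mul_eq_zero.mp this).resolve_left hF0
  have hsub : Ω ⊆ B := by
    have h1 : Ω \ Metric.closedBall (0 : EuclideanSpace ℝ (Fin (n + 1))) R = ∅ := by
      have ho : IsOpen (Ω \ Metric.closedBall (0 : EuclideanSpace ℝ (Fin (n + 1))) R) :=
        hΩ.sdiff Metric.isClosed_closedBall
      rw [← ho.measure_eq_zero_iff (μ := volume)]
      exact measure_mono_null (diff_subset_diff_right Metric.ball_subset_closedBall) z2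
    have h2 : Ω ⊆ Metric.closedBall (0 : EuclideanSpace ℝ (Fin (n + 1))) R := diff_eq_empty.mp h1
    have h3 := interior_maximal h2 hΩ
    rwa [interior_closedBall _ hR.ne'] at h3
  have hopen : ∀ O : Set (EuclideanSpace ℝ (Fin (n + 1))), IsOpen O → O ⊆ B → Disjoint O Ω → O = ∅ := by
    intro O hO h1 h2
    rw [← hO.measure_eq_zero_iff (μ := volume)]
    have hs : O ⊆ B \ Ω := fun x hx => ⟨h1 hx, fun h => disjoint_left.mp h2 hx h⟩
    exact measure_mono_null hs z1
  refine subset_antisymm hsub fun p hpB => ?_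
  by_contra hp
  have hcl : p ∈ closure Ω := by
    by_contra h
    have := hopen (B ∩ (closure Ω)ᶜ) (hBo.inter isClosed_closure.isOpen_compl) inter_subset_left
      (disjoint_left.mpr fun x hx hx' => hx.2 (subset_closure hx'))
    exact (this ▸ (⟨hpB, h⟩ : p ∈ B ∩ (closure Ω)ᶜ) : p ∈ (∅ : Set _))
  obtain ⟨U, φ, hU, hpU, hφ, hdφ, hΩU⟩ := hsm p ⟨hcl, by rwa [hΩ.interior_eq]⟩
  have hφp : 0 ≤ φ p := by
    by_contra h
    have : p ∈ Ω ∩ U := by rw [hΩU]; exact ⟨hpU, not_le.mp h⟩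
    exact hp this.1
  have hE := hopen (U ∩ B ∩ {q | 0 < φ q}) ((hU.inter hBo).inter (isOpen_lt continuous_const hφ.continuous))
    (fun x hx => hx.1.2) (disjoint_left.mpr fun x hx hx' => by
      have : x ∈ Ω ∩ U := ⟨hx', hx.1.1⟩
      rw [hΩU] at this
      exact absurd this.2 (not_lt.mpr (le_of_lt hx.2)))
  have hmax : IsLocalMax φ p := by
    filter_upwards [(hU.inter hBo).mem_nhds ⟨hpU, hpB⟩] with q hq
    refine le_trans ?_ hφp
    by_contra h
    exact (hE ▸ (⟨hq, not_le.mp h⟩ : q ∈ U ∩ B ∩ {q | 0 < φ q}) : q ∈ (∅ : Set _))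
  exact hdφ p hpU hmax.fderiv_eq_zero

end final

/-- Faber–Krahn inequality for the density `f(x) = exp(c|x|²)`,
`c > 0`, on `ℝ^{n+1}`:  for a bounded connected open set `Ω` with smooth boundary and
the round ball `B` about the origin with the same weighted volume,
`λ₁(Ω) ≥ λ₁(B)`, with equality iff `Ω = B`. -/
theorem faber_krahn_exp_norm_sq_density
    (n : ℕ) (hn : 1 ≤ n) (c : ℝ) (hc : 0 < c)
    (f : EuclideanSpace ℝ (Fin (n + 1)) → ℝ)
    (hf : ∀ x : EuclideanSpace ℝ (Fin (n + 1)), f x = Real.exp (c * ‖x‖ ^ 2))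
    (Ω : Set (EuclideanSpace ℝ (Fin (n + 1))))
    (hΩopen : IsOpen Ω) (hΩbdd : Bornology.IsBounded Ω) (hΩconn : IsConnected Ω)
    (hΩsmooth : HasSmoothBoundary Ω)
    (R : ℝ) (hR : 0 < R)
    (hvol : wvol f (Metric.ball (0 : EuclideanSpace ℝ (Fin (n + 1))) R) = wvol f Ω) :
    lambdaOne f (Metric.ball (0 : EuclideanSpace ℝ (Fin (n + 1))) R) ≤ lambdaOne f Ω ∧
    (lambdaOne f Ω = lambdaOne f (Metric.ball (0 : EuclideanSpace ℝ (Fin (n + 1))) R)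
      ↔ Ω = Metric.ball (0 : EuclideanSpace ℝ (Fin (n + 1))) R) := by

  obtain rfl : f = fun x => Real.exp (c * ‖x‖ ^ 2) := funext hf
  rcases lt_or_ge (volume Ω) (volume (Metric.ball (0 : EuclideanSpace ℝ (Fin (n + 1))) R)) with h | h
  · have hs := fk_strict hn hc hR hΩopen hΩconn.nonempty h
    refine ⟨hs.le, fun e => absurd e hs.ne', fun e => ?_⟩
    rw [e] at h
    exact absurd h (lt_irrefl _)
  · have e := fk_eq_ball hc hR hΩopen hΩsmooth hvol h
    rw [e]
    simp
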